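/- arXiv:0806.4024 — 2 statements merged into one kernel-verified Lean document; each statement's English description precedes it below -/
import Mathlib

section
/- Let p be a prime, d ≥ 1, and let G be a closed subgroup of GL_d(ℤ_p) which has no soluble subgroup of finite index. Then G meets 2^{ℵ0} orbits of the conjugation action of GL_d(ℤ_p) on itself; in particular, there is a family of 2^{ℵ0} elements of G that are pairwise non-conjugate in GL_d(ℤ_p). -/
open Cardinal
open scoped MatrixGroups




open Polynomial
open scoped commutatorElement


theorem nilp_of_trace {K n : Type*} [Field K] [CharZero K] [Fintype n] [DecidableEq n]
    (a : Matrix n n K) (h : ∀ q : K[X], (aeval a q * a).trace = 0) : IsNilpotent a := by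
  obtain ⟨q, hq, hq0⟩ := Polynomial.exists_eq_pow_rootMultiplicity_mul_and_not_dvd a.charpoly
    a.charpoly_monic.ne_zero 0
  set k := a.charpoly.rootMultiplicity 0
  simp only [map_zero, sub_zero] at hq hq0
  have hcop : IsCoprime (X ^ (k+1) : K[X]) q :=
    ((Polynomial.irreducible_X (R := K)).coprime_iff_not_dvd.2 hq0).pow_left
  obtain ⟨u, v, huv⟩ := hcop
  have hch : a ^ k * aeval a q = 0 := by
    have := Matrix.aeval_self_charpoly a
    rw [hq] at this
    simpa using this
  have h1 : aeval a u * a ^ (k+1) + aeval a v * aeval a q = 1 := by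
    have := congrArg (aeval a) huv
    simpa using this
  have hcomm : ∀ f g : K[X], aeval a f * aeval a g = aeval a g * aeval a f := fun f g => by
    rw [← map_mul, mul_comm, map_mul]
  set e := aeval a u * a ^ (k+1) with he
  have heq : aeval a (u * X ^ (k+1)) = e := by simp [he]
  have hvq : aeval a v * aeval a q = 1 - e := by rw [← h1]; simp
  have hz : e * (1 - e) = 0 := by
    have h2 : e * (1 - e) = aeval a (u * X * v) * (a ^ k * aeval a q) := by
      have h7 : e = aeval a (u * X) * a ^ k := by
        rw [he, pow_succ', map_mul, aeval_X, mul_assoc]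
      have h8 : a ^ k = aeval a (X ^ k : K[X]) := by simp
      rw [← hvq, h7, map_mul (aeval a) (u * X) v, mul_assoc, mul_assoc]
      congr 1
      rw [← mul_assoc, ← mul_assoc, h8, hcomm v]
    rw [h2, hch, mul_zero]
  have hid : IsIdempotentElem e := by
    rw [mul_sub, mul_one, sub_eq_zero] at hz
    exact hz.symm
  have htr : e.trace = 0 := by
    have := h (u * X ^ k)
    simpa [he, pow_succ, mul_assoc] using this
  have he0 : e = 0 := by
    have h3 : IsIdempotentElem (Matrix.toLin' e) := by
      have h4 := Matrix.toLin'_mul e e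
      rw [hid.eq] at h4
      exact h4.symm
    have := LinearMap.IsIdempotentElem.eq_zero_of_trace_eq_zero h3 (by simpa using htr)
    simpa using this
  refine ⟨k, ?_⟩
  rw [he0, sub_zero] at hvq
  calc a ^ k = a ^ k * (aeval a q * aeval a v) := by rw [hcomm, hvq, mul_one]
    _ = 0 := by rw [← mul_assoc, hch, zero_mul]

theorem kolchin {Γ K n : Type*} [Group Γ] [Field K] [CharZero K] [Fintype n] [DecidableEq n]
    (ρ : Γ →* Matrix n n K) (hρ : Function.Injective ρ)
    (h : ∀ g, (ρ g).trace = Fintype.card n) : Group.IsSolvable Γ := by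
  let R : Subalgebra K (Matrix n n K) := Algebra.adjoin K (MonoidHom.mrange ρ : Set (Matrix n n K))
  have hmem : ∀ g, ρ g ∈ R := fun g => Algebra.subset_adjoin ⟨g, rfl⟩
  let σ : Γ →* R := ρ.codRestrict R hmem
  have hσ : Function.Injective σ := fun x y hxy => hρ (congrArg Subtype.val hxy)
  have hspan : ∀ {x}, x ∈ Submodule.span K (MonoidHom.mrange ρ : Set (Matrix n n K)) → x ∈ R :=
    fun hx => Algebra.span_le_adjoin K _ hx
  have htr : ∀ g, ∀ b ∈ R, (b * (ρ g - 1)).trace = 0 := by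
    intro g b hb
    have hb' : b ∈ Submodule.span K (MonoidHom.mrange ρ : Set (Matrix n n K)) := by
      have h5 := Algebra.adjoin_eq_span K (MonoidHom.mrange ρ : Set (Matrix n n K))
      rw [Submonoid.closure_eq] at h5
      rw [← h5]; exact hb
    induction hb' using Submodule.span_induction with
    | mem x hx =>
      obtain ⟨y, rfl⟩ := hx
      rw [mul_sub, mul_one, Matrix.trace_sub, ← map_mul, h, h, sub_self]
    | zero => simp
    | add x y hx hy ihx ihy =>
      rw [add_mul, Matrix.trace_add]
      rw [ihx (hspan hx), ihy (hspan hy), add_zero]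
    | smul c x hx ih =>
      rw [smul_mul_assoc, Matrix.trace_smul, ih (hspan hx), smul_zero]
  have : IsArtinianRing R := IsArtinianRing.of_finite K R
  have hnil : IsNilpotent (Ring.jacobson R) := IsSemiprimaryRing.isNilpotent
  have hJ : ∀ g, σ g - 1 ∈ Ring.jacobson R := by
    intro g
    rw [← Ideal.jacobson_bot, Ideal.mem_jacobson_iff]
    intro y
    have hn : IsNilpotent (y * (σ g - 1)) := by
      have : IsNilpotent ((y * (σ g - 1) : R) : Matrix n n K) := by
        apply nilp_of_trace
        intro q
        have h6 : aeval ((y * (σ g - 1) : R) : Matrix n n K) q ∈ R :=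
          Algebra.adjoin_le (S := R) (Set.singleton_subset_iff.2 (Subtype.prop _))
            (Polynomial.aeval_mem_adjoin_singleton K _)
        have := htr g (aeval ((y * (σ g - 1) : R) : Matrix n n K) q * y) (R.mul_mem h6 y.2)
        rw [mul_assoc] at this
        exact this
      obtain ⟨k, hk⟩ := this
      exact ⟨k, Subtype.ext (by simpa using hk)⟩
    obtain ⟨z, hz⟩ := hn.isUnit_one_add.exists_left_inv
    refine ⟨z, ?_⟩
    rw [mul_add, mul_one] at hz
    rw [Ideal.mem_bot, sub_eq_zero, mul_assoc, add_comm]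
    exact hz
  obtain ⟨m, hm⟩ := hnil
  set J := Ring.jacobson R
  have key : ∀ k, ∀ g ∈ derivedSeries Γ k, σ g - 1 ∈ J ^ (k+1) := by
    intro k
    induction k with
    | zero => intro g _; rw [zero_add, Submodule.pow_one]; exact hJ g
    | succ k ih =>
      let S : Subgroup Γ :=
        { carrier := {g | σ g - 1 ∈ J ^ (k+1+1)}
          one_mem' := by simp
          mul_mem' := by
            intro a b ha hb
            simp only [Set.mem_ofPred_eq] at *
            have : σ (a * b) - 1 = σ a * (σ b - 1) + (σ a - 1) := by
              rw [map_mul, mul_sub, mul_one, sub_add_sub_cancel]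
            rw [this]
            exact add_mem (Ideal.mul_mem_left _ _ hb) ha
          inv_mem' := by
            intro a ha
            simp only [Set.mem_ofPred_eq] at *
            have : σ a⁻¹ - 1 = - (σ a⁻¹ * (σ a - 1)) := by
              rw [mul_sub, ← map_mul]; simp
            rw [this]
            exact neg_mem (Ideal.mul_mem_left _ _ ha) }
      have : derivedSeries Γ (k+1) ≤ S := by
        rw [derivedSeries_succ, Subgroup.commutator_le]
        intro a ha b hb
        change σ ⁅a, b⁆ - 1 ∈ J ^ (k+1+1)
        have e : σ ⁅a, b⁆ - 1 = ((σ a - 1) * (σ b - 1) - (σ b - 1) * (σ a - 1)) * σ (a⁻¹ * b⁻¹) := by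
          have e1 : (σ a - 1) * (σ b - 1) - (σ b - 1) * (σ a - 1) = σ (a * b) - σ (b * a) := by
            rw [map_mul, map_mul]; simp only [mul_sub, sub_mul, mul_one, one_mul]; abel
          rw [e1, sub_mul, ← map_mul, ← map_mul, commutatorElement_def]
          have : b * a * (a⁻¹ * b⁻¹) = 1 := by group
          rw [this, map_one, ← mul_assoc]
        rw [e]
        have hle : J ^ (k+1) ≤ J := Ideal.pow_le_self (by omega)
        have hm' : ∀ x ∈ J ^ (k+1), ∀ y ∈ J ^ (k+1), x * y ∈ J ^ (k+1+1) := by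
          intro x hx y hy
          rw [Submodule.pow_succ (M := J) (n := k+1) ]
          exact Ideal.mul_mem_mul hx (hle hy)
        exact Ideal.mul_mem_right _ _ (sub_mem (hm' _ (ih a ha) _ (ih b hb)) (hm' _ (ih b hb) _ (ih a ha)))
      exact this
  refine ⟨⟨m, ?_⟩⟩
  rw [eq_bot_iff]
  intro g hg
  have := key m g hg
  rw [Submodule.pow_succ, hm] at this
  rw [Submodule.zero_eq_bot, Submodule.bot_mul, Submodule.mem_bot, sub_eq_zero] at this
  rw [Subgroup.mem_bot]
  apply hσ
  rw [this, map_one]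


/-- roots of unity congruent to 1 mod p^2 -/
theorem root_unity_one (p : ℕ) [hp : Fact p.Prime] {L : Type*} [Field L] [Algebra ℤ_[p] L]
    [Algebra ℚ_[p] L] [IsScalarTower ℤ_[p] ℚ_[p] L] (y : L) (hy : IsIntegral ℤ_[p] y)
    (m : ℕ) (hm : 0 < m) (h : (1 + (p:L)^2 * y) ^ m = 1) : (1 + (p:L)^2 * y) = 1 := by
  set l := 1 + (p:L)^2 * y with hl
  by_contra hne
  have hlint : IsIntegral ℤ_[p] l := by
    have h1 : IsIntegral ℤ_[p] (p:L) := by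
      simpa using (isIntegral_algebraMap (R := ℤ_[p]) (A := L) (x := (p : ℤ_[p])))
    exact isIntegral_one.add ((h1.pow 2).mul hy)
  have hfin : IsOfFinOrder l := isOfFinOrder_iff_pow_eq_one.2 ⟨m, hm, h⟩
  have hn1 : orderOf l ≠ 1 := by rwa [Ne, orderOf_eq_one_iff]
  set q := (orderOf l).minFac with hq
  have hqp : q.Prime := Nat.minFac_prime hn1
  obtain ⟨s, hs⟩ := Nat.minFac_dvd (orderOf l)
  have hn0 : 0 < orderOf l := hfin.orderOf_pos
  set μ := l ^ s with hμ
  have hμq : μ ^ q = 1 := by rw [hμ, ← pow_mul, mul_comm, ← hs, pow_orderOf_eq_one]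
  have hμ1 : μ ≠ 1 := by
    intro h1
    have := orderOf_dvd_of_pow_eq_one h1
    have hs0 : 0 < s := by
      rcases Nat.eq_zero_or_pos s with h0 | h0
      · rw [h0] at hs; omega
      · exact h0
    have h2 := Nat.le_of_dvd hs0 this
    have h3 := hqp.two_le
    rw [hs] at h2
    nlinarith
  have hsum : ∑ i ∈ Finset.range q, μ ^ i = 0 := by
    have := mul_geom_sum μ q
    rw [hμq, sub_self] at this
    exact (mul_eq_zero.1 this).resolve_left (sub_ne_zero.2 hμ1)
  have hgeo : ∀ k, IsIntegral ℤ_[p] (∑ i ∈ Finset.range k, l ^ i) := fun k =>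
    IsIntegral.sum _ fun i _ => hlint.pow i
  -- q = p^2 * w
  obtain ⟨w, hw, hwq⟩ : ∃ w : L, IsIntegral ℤ_[p] w ∧ (q : L) = (p:L)^2 * w := by
    refine ⟨-∑ i ∈ Finset.range q, y * ∑ j ∈ Finset.range (s*i), l ^ j, ?_, ?_⟩
    · exact (IsIntegral.sum _ fun i _ => hy.mul (hgeo _)).neg
    · have : ∀ i, μ ^ i = 1 + (p:L)^2 * (y * ∑ j ∈ Finset.range (s*i), l ^ j) := by
        intro i
        have := mul_geom_sum l (s*i)
        rw [← mul_assoc, show (p:L)^2 * y = l - 1 by rw [hl]; ring, this, hμ, pow_mul]; ring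
      simp_rw [this, Finset.sum_add_distrib, ← Finset.mul_sum] at hsum
      simp only [Finset.sum_const, Finset.card_range, nsmul_eq_mul, mul_one] at hsum
      simp only [← Finset.mul_sum]
      linear_combination hsum
  -- contradiction
  have hp0 : (p : L) ≠ 0 := by
    rw [← map_natCast (algebraMap ℚ_[p] L), Ne, map_eq_zero_iff _ (algebraMap ℚ_[p] L).injective]
    exact_mod_cast hp.1.ne_zero
  have hdvd : (p : ℤ_[p])^2 ∣ (q : ℤ_[p]) := by
    have hp0' : (p : ℚ_[p]) ≠ 0 := by exact_mod_cast hp.1.ne_zero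
    have hwe : w = algebraMap ℚ_[p] L ((q : ℚ_[p]) / (p : ℚ_[p])^2) := by
      simp only [map_div₀, map_pow, map_natCast]
      rw [hwq]; field_simp
    rw [hwe, isIntegral_algebraMap_iff (algebraMap ℚ_[p] L).injective,
      IsIntegrallyClosed.isIntegral_iff] at hw
    obtain ⟨z, hz⟩ := hw
    refine ⟨z, ?_⟩
    apply Subtype.coe_injective
    have : (z : ℚ_[p]) = (q : ℚ_[p]) / (p : ℚ_[p])^2 := hz
    push_cast
    rw [this]; field_simp
  have h2 : p^2 ∣ q := by
    have := (PadicInt.norm_int_le_pow_iff_dvd (p := p) (k := (q:ℤ)) (n := 2)).1 (by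
      have := (PadicInt.norm_le_pow_iff_mem_span_pow (p := p) (q : ℤ_[p]) 2).2 (Ideal.mem_span_singleton.2 hdvd)
      simpa using this)
    exact_mod_cast this
  have h3 := (Nat.dvd_prime hqp).1 h2
  have h4 := hp.1.two_le
  rcases h3 with h3 | h3
  · nlinarith
  · rw [← h3] at hqp
    exact Nat.Prime.not_prime_pow le_rfl hqp

theorem trace_eq_of_const (p : ℕ) [hp : Fact p.Prime] (d : ℕ) (g : GL (Fin d) ℤ_[p])
    (Y : Matrix (Fin d) (Fin d) ℤ_[p]) (hg : (g : Matrix (Fin d) (Fin d) ℤ_[p]) = 1 + (p : ℤ_[p])^2 • Y)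
    (S : Set ℕ) (hS : S.Infinite) (P : ℤ_[p][X])
    (hP : ∀ n ∈ S, ((g : Matrix (Fin d) (Fin d) ℤ_[p]) ^ n).charpoly = P) :
    (g : Matrix (Fin d) (Fin d) ℤ_[p]).trace = d := by
  classical
  let L := AlgebraicClosure ℚ_[p]
  let φ : ℤ_[p] →+* L := algebraMap ℤ_[p] L
  have hφ : Function.Injective φ := by
    have : φ = (algebraMap ℚ_[p] L).comp (algebraMap ℤ_[p] ℚ_[p]) :=
      IsScalarTower.algebraMap_eq ℤ_[p] ℚ_[p] L
    rw [this]
    exact (algebraMap ℚ_[p] L).injective.comp (IsFractionRing.injective ℤ_[p] ℚ_[p])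
  have hp0 : (p : L) ≠ 0 := by
    rw [← map_natCast φ, Ne, map_eq_zero_iff _ hφ]
    exact_mod_cast hp.1.ne_zero
  let A : Matrix (Fin d) (Fin d) ℤ_[p] := g
  let M : Matrix (Fin d) (Fin d) L := φ.mapMatrix A
  have hM : M = 1 + (p : L)^2 • φ.mapMatrix Y := by
    ext i j
    have := congrFun (congrFun hg i) j
    simp only [M, A, this, RingHom.mapMatrix_apply, Matrix.map_apply]
    by_cases h : i = j <;> simp [h]
  have hMu : IsUnit M := (g.isUnit).map φ.mapMatrix
  have hPm : P.Monic := by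
    obtain ⟨n, hn⟩ := hS.nonempty
    rw [← hP n hn]; exact Matrix.charpoly_monic _
  have hroot : ∀ l ∈ M.charpoly.roots, l = 1 := by
    intro l hl
    have hl1 : M.charpoly.IsRoot l := (Polynomial.mem_roots'.1 hl).2
    have hl2 : l ∈ spectrum L M := Matrix.mem_spectrum_iff_isRoot_charpoly.2 hl1
    have hl0 : l ≠ 0 := by
      rintro rfl
      exact spectrum.zero_notMem L hMu hl2
    have hpow : ∀ n ∈ S, l ^ n ∈ (P.map φ).roots.toFinset := by
      intro n hn
      have h1 : l ^ n ∈ spectrum L (M ^ n) := spectrum.pow_mem_pow M n hl2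
      rw [Matrix.mem_spectrum_iff_isRoot_charpoly] at h1
      have h2 : (M ^ n).charpoly = P.map φ := by
        rw [← hP n hn, ← Matrix.charpoly_map]
        congr 1
        exact (map_pow φ.mapMatrix A n).symm
      rw [Multiset.mem_toFinset, Polynomial.mem_roots (hPm.map φ).ne_zero, ← h2]
      exact h1
    obtain ⟨n, hn, m, hm, hnm, he⟩ := hS.exists_ne_map_eq_of_mapsTo
      (f := fun n => l ^ n) (t := ((P.map φ).roots.toFinset : Set L)) hpow (Finset.finite_toSet _)
    have hfin : ∃ k, 0 < k ∧ l ^ k = 1 := by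
      have aux : ∀ a b : ℕ, a < b → l ^ a = l ^ b → ∃ k, 0 < k ∧ l ^ k = 1 := by
        intro a b hab h
        refine ⟨b - a, by omega, ?_⟩
        have h3 : l ^ b = l ^ a * l ^ (b - a) := by rw [← pow_add]; congr 1; omega
        rw [h3] at h
        exact (mul_right_eq_self₀.1 h.symm).resolve_right (pow_ne_zero _ hl0)
      rcases lt_or_gt_of_ne hnm with h | h
      · exact aux n m h he
      · exact aux m n h he.symm
    obtain ⟨k, hk, hlk⟩ := hfin
    set y : L := (l - 1) / (p : L)^2 with hy
    have hly : l = 1 + (p : L)^2 * y := by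
      rw [hy, mul_div_cancel₀ _ (pow_ne_zero 2 hp0)]; ring
    have hyint : IsIntegral ℤ_[p] y := by
      refine ⟨Y.charpoly, Y.charpoly_monic, ?_⟩
      rw [← Polynomial.eval_map]
      change (Polynomial.map φ Y.charpoly).eval y = 0
      rw [← Matrix.charpoly_map, Matrix.eval_charpoly]
      have h4 : (Matrix.scalar (Fin d) l - M).det = 0 := by
        rw [← Matrix.eval_charpoly]; exact hl1
      have h5 : Matrix.scalar (Fin d) l - M = (p : L)^2 • (Matrix.scalar (Fin d) y - Y.map φ) := by
        rw [hM, hly]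
        ext i j
        by_cases h : i = j <;> simp [h, Matrix.scalar_apply] <;> ring
      rw [h5, Matrix.det_smul] at h4
      exact (mul_eq_zero.1 h4).resolve_left (pow_ne_zero _ (pow_ne_zero _ hp0))
    rw [hly] at hlk ⊢
    exact root_unity_one p y hyint k hk hlk
  have htr : M.trace = d := by
    rw [Matrix.trace_eq_sum_roots_charpoly, Multiset.eq_replicate_card.2 hroot]
    have hs := (IsAlgClosed.splits M.charpoly).natDegree_eq_card_roots
    rw [Matrix.charpoly_natDegree_eq_dim, Fintype.card_fin] at hs
    rw [← hs]; simp
  apply hφ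
  rw [map_natCast, ← htr]
  simp [Matrix.trace, M, A]

theorem compactSpace_gl (p : ℕ) [Fact p.Prime] (d : ℕ) : CompactSpace (GL (Fin d) ℤ_[p]) := by
  have : CompactSpace (Matrix (Fin d) (Fin d) ℤ_[p]) :=
    inferInstanceAs (CompactSpace (Fin d → Fin d → ℤ_[p]))
  exact inferInstanceAs (CompactSpace (Matrix (Fin d) (Fin d) ℤ_[p])ˣ)

/-- values of the characteristic polynomial -/
noncomputable def charVals (p : ℕ) [Fact p.Prime] (d : ℕ) (g : GL (Fin d) ℤ_[p]) : ℕ → ℤ_[p] :=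
  fun n => (g : Matrix (Fin d) (Fin d) ℤ_[p]).charpoly.eval (n : ℤ_[p])

theorem charVals_continuous (p : ℕ) [Fact p.Prime] (d : ℕ) : Continuous (charVals p d) := by
  refine continuous_pi fun n => ?_
  simp only [charVals, Matrix.eval_charpoly]
  exact (continuous_const.sub Units.continuous_val).matrix_det

theorem charVals_conj (p : ℕ) [Fact p.Prime] (d : ℕ) {g h : GL (Fin d) ℤ_[p]} (H : IsConj g h) :
    charVals p d g = charVals p d h := by
  obtain ⟨c, rfl⟩ := isConj_iff.1 H
  have h1 : ((c * g * c⁻¹ : GL (Fin d) ℤ_[p]) : Matrix (Fin d) (Fin d) ℤ_[p]).charpoly =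
      (g : Matrix (Fin d) (Fin d) ℤ_[p]).charpoly := by
    rw [Units.val_mul, Units.val_mul, Matrix.coe_units_inv]
    exact Matrix.charpoly_units_conj c _
  funext n
  unfold charVals
  rw [h1]

theorem charVals_inj (p : ℕ) [Fact p.Prime] (d : ℕ) {g h : GL (Fin d) ℤ_[p]}
    (H : charVals p d g = charVals p d h) :
    (g : Matrix (Fin d) (Fin d) ℤ_[p]).charpoly = (h : Matrix (Fin d) (Fin d) ℤ_[p]).charpoly := by
  apply Polynomial.eq_of_infinite_eval_eq
  refine (Set.infinite_range_of_injective (Nat.cast_injective (R := ℤ_[p]))).mono ?_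
  rintro _ ⟨n, rfl⟩
  exact congrFun H n

theorem uncountable_image (p : ℕ) [hp : Fact p.Prime] (d : ℕ) (g : GL (Fin d) ℤ_[p])
    (Y : Matrix (Fin d) (Fin d) ℤ_[p]) (hg : (g : Matrix (Fin d) (Fin d) ℤ_[p]) = 1 + (p : ℤ_[p])^2 • Y)
    (ht : (g : Matrix (Fin d) (Fin d) ℤ_[p]).trace ≠ d) (G : Subgroup (GL (Fin d) ℤ_[p]))
    (hG : IsClosed (G : Set (GL (Fin d) ℤ_[p]))) (hgG : g ∈ G) :
    ¬ (charVals p d '' G).Countable := by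
  intro hc
  have : CompactSpace (GL (Fin d) ℤ_[p]) := compactSpace_gl p d
  let C : Subgroup (GL (Fin d) ℤ_[p]) := (Subgroup.zpowers g).topologicalClosure
  have hCc : IsClosed (C : Set (GL (Fin d) ℤ_[p])) := Subgroup.isClosed_topologicalClosure _
  have hCG : C ≤ G := Subgroup.topologicalClosure_minimal _ (Subgroup.zpowers_le.2 hgG) hG
  have : CompactSpace C := isCompact_iff_compactSpace.1 hCc.isCompact
  have : Countable (charVals p d '' G) := hc.to_subtype
  obtain ⟨v, x, hx⟩ := nonempty_interior_of_iUnion_of_closed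
    (X := C) (ι := charVals p d '' G) (f := fun v => {c : C | charVals p d c = v})
    (fun v => isClosed_singleton.preimage ((charVals_continuous p d).comp continuous_subtype_val))
    (by
      ext c
      simp only [Set.mem_iUnion, Set.mem_univ, iff_true]
      exact ⟨⟨_, c, hCG c.2, rfl⟩, rfl⟩)
  rw [mem_interior_iff_mem_nhds, nhds_subtype, Filter.mem_comap] at hx
  obtain ⟨t, ht1, ht2⟩ := hx
  have ht3 : ∀ c : C, (c : GL (Fin d) ℤ_[p]) ∈ t → charVals p d c = v := by
    intro c hc
    have h1 := ht2 (Set.mem_preimage.2 hc)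
    exact h1
  have hcl : MapClusterPt (x : GL (Fin d) ℤ_[p]) Filter.atTop (g ^ · : ℕ → GL (Fin d) ℤ_[p]) :=
    mapClusterPt_atTop_pow_iff_mem_topologicalClosure_zpowers.2 x.2
  have hfr := hcl.frequently ht1
  rw [Nat.frequently_atTop_iff_infinite] at hfr
  have hval : ∀ n ∈ {n : ℕ | g ^ n ∈ t}, charVals p d (g ^ n) = v := by
    intro n hn
    have hm : g ^ n ∈ C := Subgroup.le_topologicalClosure _ (Subgroup.npow_mem_zpowers g n)
    rw [Set.mem_ofPred_eq] at hn
    exact ht3 ⟨g ^ n, hm⟩ hn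
  obtain ⟨n0, hn0⟩ := hfr.nonempty
  apply ht
  refine trace_eq_of_const p d g Y hg _ hfr ((g ^ n0 : GL (Fin d) ℤ_[p]) : Matrix (Fin d) (Fin d) ℤ_[p]).charpoly ?_
  intro n hn
  have e : ((g ^ n : GL (Fin d) ℤ_[p]) : Matrix (Fin d) (Fin d) ℤ_[p]) =
    (g : Matrix (Fin d) (Fin d) ℤ_[p]) ^ n := Units.val_pow_eq_pow_val g n
  rw [← e]
  exact charVals_inj p d ((hval n hn).trans (hval n0 hn0).symm)

theorem card_padicInt_le (p : ℕ) [hp : Fact p.Prime] : #ℤ_[p] ≤ Cardinal.continuum := by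
  have hinj : Function.Injective (fun (x : ℤ_[p]) (n : ℕ) => (PadicInt.toZModPow n x).val) := by
    intro x y h
    refine PadicInt.ext_of_toZModPow.1 fun n => ?_
    have : NeZero (p ^ n) := ⟨pow_ne_zero _ hp.1.ne_zero⟩
    exact ZMod.val_injective _ (congrFun h n)
  have := Cardinal.mk_le_of_injective hinj
  simpa using this

theorem card_gl_le (p : ℕ) [hp : Fact p.Prime] (d : ℕ) :
    #(GL (Fin d) ℤ_[p]) ≤ Cardinal.continuum := by
  have h1 : #(GL (Fin d) ℤ_[p]) ≤ #(ℕ → ℤ_[p]) := by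
    refine Cardinal.mk_le_of_injective
      (f := fun g n => if h : n < d * d then
        (g : Matrix (Fin d) (Fin d) ℤ_[p]) (finProdFinEquiv.symm ⟨n, h⟩).1 (finProdFinEquiv.symm ⟨n, h⟩).2 else 0) ?_
    intro g h hgh
    ext i j
    have h2 := congrFun hgh (finProdFinEquiv (i, j) : ℕ)
    have h3 : ((finProdFinEquiv (i, j) : Fin (d * d)) : ℕ) < d * d := (finProdFinEquiv (i, j)).2
    simp only [dif_pos h3, Fin.eta, Equiv.symm_apply_apply] at h2
    exact h2
  refine h1.trans ?_
  rw [← Cardinal.power_def, Cardinal.mk_nat, ← Cardinal.continuum_power_aleph0]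
  exact Cardinal.power_le_power_right (card_padicInt_le p)

/-- A closed subgroup of `GL_d(ℤ_p)` with no soluble subgroup of finite
index meets `2^ℵ₀` conjugacy classes of `GL_d(ℤ_p)`; in particular it contains a family of
`2^ℵ₀` pairwise non-conjugate elements. -/
theorem statement14 (p : ℕ) [Fact p.Prime] (d : ℕ) (hd : 1 ≤ d)
    (G : Subgroup (GL (Fin d) ℤ_[p]))
    (hGclosed : IsClosed (G : Set (GL (Fin d) ℤ_[p])))
    (hnonsol : ∀ H : Subgroup G, H.index ≠ 0 → ¬ IsSolvable H) :
    #(Set.range fun g : G => ConjClasses.mk (g : GL (Fin d) ℤ_[p])) = Cardinal.continuum ∧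
    ∃ s : Set (GL (Fin d) ℤ_[p]), s ⊆ (G : Set (GL (Fin d) ℤ_[p])) ∧
      #s = Cardinal.continuum ∧
      ∀ x ∈ s, ∀ y ∈ s, x ≠ y → ¬ IsConj x y := by
  have hp : p.Prime := Fact.out
  have : NeZero (p ^ 2) := ⟨pow_ne_zero _ hp.ne_zero⟩
  let π : GL (Fin d) ℤ_[p] →* GL (Fin d) (ZMod (p^2)) :=
    Matrix.GeneralLinearGroup.map (PadicInt.toZModPow 2)
  let f : G →* GL (Fin d) (ZMod (p^2)) := π.comp G.subtype
  let H : Subgroup G := f.ker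
  have hidx : H.index ≠ 0 := by
    have : Finite (GL (Fin d) (ZMod (p^2))) := inferInstance
    exact (Subgroup.finiteIndex_ker f).index_ne_zero
  have hns := hnonsol H hidx
  obtain ⟨g, hgG, hgπ, hgt⟩ : ∃ g ∈ G, π g = 1 ∧ (g : Matrix (Fin d) (Fin d) ℤ_[p]).trace ≠ d := by
    by_contra hcon
    push Not at hcon
    apply hns
    let ρ : H →* Matrix (Fin d) (Fin d) ℚ_[p] :=
      ((algebraMap ℤ_[p] ℚ_[p]).mapMatrix (m := Fin d)).toMonoidHom.comp
        ((Units.coeHom _).comp (G.subtype.comp H.subtype))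
    have hρ : Function.Injective ρ := by
      intro a b hab
      apply Subtype.ext
      apply Subtype.ext
      apply Units.ext
      exact Matrix.map_injective (IsFractionRing.injective ℤ_[p] ℚ_[p]) hab
    refine kolchin ρ hρ ?_
    intro h
    have := hcon h.1.1 h.1.2 h.2
    have h2 : (ρ h).trace = algebraMap ℤ_[p] ℚ_[p]
        ((h.1.1 : GL (Fin d) ℤ_[p]) : Matrix (Fin d) (Fin d) ℤ_[p]).trace := by
      simp [ρ, Matrix.trace]
    rw [h2, this]; simp
  obtain ⟨Y, hY⟩ : ∃ Y : Matrix (Fin d) (Fin d) ℤ_[p],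
      (g : Matrix (Fin d) (Fin d) ℤ_[p]) = 1 + (p : ℤ_[p])^2 • Y := by
    have hent : ∀ i j, ∃ y : ℤ_[p], (g : Matrix (Fin d) (Fin d) ℤ_[p]) i j =
        (1 : Matrix (Fin d) (Fin d) ℤ_[p]) i j + (p : ℤ_[p])^2 * y := by
      intro i j
      have h1 : PadicInt.toZModPow 2 ((g : Matrix (Fin d) (Fin d) ℤ_[p]) i j)
          = (1 : Matrix (Fin d) (Fin d) (ZMod (p^2))) i j := by
        have := congrArg (fun u : GL (Fin d) (ZMod (p^2)) => (u : Matrix (Fin d) (Fin d) (ZMod (p^2))) i j) hgπ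
        simpa [π] using this
      have h2 : (g : Matrix (Fin d) (Fin d) ℤ_[p]) i j - (1 : Matrix (Fin d) (Fin d) ℤ_[p]) i j
          ∈ RingHom.ker (PadicInt.toZModPow (p := p) 2) := by
        rw [RingHom.mem_ker, map_sub, h1]
        by_cases h : i = j
        · subst h; simp
        · simp [Matrix.one_apply_ne h]
      rw [PadicInt.ker_toZModPow, Ideal.mem_span_singleton] at h2
      obtain ⟨y, hy⟩ := h2
      exact ⟨y, by rw [← hy]; ring⟩
    choose Y hY using hent
    exact ⟨Matrix.of Y, by ext1 i j; simpa using hY i j⟩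
  have hunc := uncountable_image p d g Y hY hgt G hGclosed hgG
  have : CompactSpace (GL (Fin d) ℤ_[p]) := compactSpace_gl p d
  have hcl : IsClosed (charVals p d '' G) :=
    (hGclosed.isCompact.image (charVals_continuous p d)).isClosed
  obtain ⟨b, hb1, -, hb3⟩ := hcl.exists_nat_bool_injection_of_not_countable hunc
  have hle : Cardinal.continuum ≤ #(charVals p d '' G) := by
    have h1 : #(ℕ → Bool) ≤ #(charVals p d '' G) :=
      Cardinal.mk_le_of_injective (f := fun z => ⟨b z, hb1 ⟨z, rfl⟩⟩)
        (fun z w h => hb3 (congrArg Subtype.val h))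
    simpa using h1
  -- a section of the map to conjugacy classes
  set T := Set.range fun g : G => ConjClasses.mk (g : GL (Fin d) ℤ_[p])
  have hT1 : Cardinal.continuum ≤ #T := by
    refine hle.trans ?_
    choose! r hr1 hr2 using fun v (hv : v ∈ charVals p d '' G) => hv
    refine Cardinal.mk_le_of_injective
      (f := fun v => ⟨ConjClasses.mk (r v.1), ⟨⟨r v.1, hr1 v.1 v.2⟩, rfl⟩⟩) ?_
    intro v w h
    have h1 := ConjClasses.mk_eq_mk_iff_isConj.1 (congrArg Subtype.val h)
    have h2 := charVals_conj p d h1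
    rw [hr2 _ v.2, hr2 _ w.2] at h2
    exact Subtype.ext h2
  choose c hc using fun t : T => t.2
  have hcinj : Function.Injective fun t : T => ((c t : G) : GL (Fin d) ℤ_[p]) := by
    intro t u h
    apply Subtype.ext
    rw [← hc t, ← hc u]
    exact congrArg ConjClasses.mk h
  have hT2 : #T ≤ Cardinal.continuum :=
    (Cardinal.mk_le_of_injective hcinj).trans (card_gl_le p d)
  have hT := le_antisymm hT2 hT1
  refine ⟨hT, Set.range fun t : T => ((c t : G) : GL (Fin d) ℤ_[p]), ?_, ?_, ?_⟩
  · rintro _ ⟨t, rfl⟩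
    exact (c t).2
  · rw [Cardinal.mk_range_eq _ hcinj, hT]
  · rintro _ ⟨t, rfl⟩ _ ⟨u, rfl⟩ hne hconj
    apply hne
    have h1 := ConjClasses.mk_eq_mk_iff_isConj.2 hconj
    have h2 : t = u := Subtype.ext ((hc t).symm.trans (h1.trans (hc u)))
    rw [h2]
end

section
/- Let p be a prime. For n ∈ ℕ let c_n be the number of conjugacy classes of the finite group PGL_2(ℤ/p^nℤ) = GL_2(ℤ/p^nℤ) modulo its subgroup of scalar matrices with unit entries (with c_0 = 1). Then the power series ∑_{n≥0} c_n t^n is ℚ-rational: it equals P(t)/Q(t) in ℚ[[t]] for some polynomials P, Q ∈ ℚ[t] with Q(0) ≠ 0. -/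
open scoped MatrixGroups

noncomputable section

/-- The central subgroup of scalar matrices with unit entries in `GL_2(R)`. -/
def scalarSub (R : Type*) [CommRing R] : Subgroup (GL (Fin 2) R) :=
  (Units.map (algebraMap R (Matrix (Fin 2) (Fin 2) R)).toMonoidHom).range

instance scalarSub_normal (R : Type*) [CommRing R] : (scalarSub R).Normal := by
  constructor
  rintro s hs g
  obtain ⟨u, rfl⟩ := hs
  refine ⟨u, (Units.ext ?_).symm⟩
  show ((g : Matrix (Fin 2) (Fin 2) R) * _) * ((g⁻¹ : GL (Fin 2) R) : Matrix (Fin 2) (Fin 2) R) = _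
  rw [Units.coe_map]
  show ((g : Matrix (Fin 2) (Fin 2) R) * algebraMap R (Matrix (Fin 2) (Fin 2) R) u) *
      ((g⁻¹ : GL (Fin 2) R) : Matrix (Fin 2) (Fin 2) R) =
    algebraMap R (Matrix (Fin 2) (Fin 2) R) u
  rw [← Algebra.commutes (u : R) (g : Matrix (Fin 2) (Fin 2) R), mul_assoc,
    show ((g : GL (Fin 2) R) : Matrix (Fin 2) (Fin 2) R) *
      ((g⁻¹ : GL (Fin 2) R) : Matrix (Fin 2) (Fin 2) R) = 1 from Units.mul_inv g, mul_one]

/-- The projective general linear group `PGL_2(R)`: the quotient of `GL_2(R)` by its subgroup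
of scalar matrices with unit entries. -/
abbrev PGL2 (R : Type*) [CommRing R] : Type _ := GL (Fin 2) R ⧸ scalarSub R

namespace PGLCount

open Matrix

/-! ## Rationality criterion -/

lemma rational_of_eventually (c : ℕ → ℚ) (r α β : ℚ)
    (h : ∀ n, 3 ≤ n → c n = α * r ^ n + β) :
    ∃ P Q : Polynomial ℚ, Q.coeff 0 ≠ 0 ∧
      PowerSeries.mk c * (Q : PowerSeries ℚ) = (P : PowerSeries ℚ) := by
  set Q : Polynomial ℚ := (1 - Polynomial.X) * (1 - Polynomial.C r * Polynomial.X) with hQ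
  set F : PowerSeries ℚ := PowerSeries.mk c * (Q : PowerSeries ℚ) with hF
  refine ⟨PowerSeries.trunc 5 F, Q, ?_, ?_⟩
  · simp [hQ, Polynomial.mul_coeff_zero]
  · ext n
    rw [Polynomial.coeff_coe, PowerSeries.coeff_trunc]
    split_ifs with hn
    · rfl
    · obtain ⟨k, rfl⟩ : ∃ k, n = k + 5 := ⟨n - 5, by omega⟩
      have hFF : F = PowerSeries.mk c - PowerSeries.mk c * PowerSeries.X
          - PowerSeries.C r * (PowerSeries.mk c * PowerSeries.X)
          + PowerSeries.C r * (PowerSeries.mk c * PowerSeries.X * PowerSeries.X) := by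
        rw [hF, hQ]
        push_cast
        ring
      rw [← hF, hFF]
      simp only [map_add, map_sub, PowerSeries.coeff_C_mul]
      rw [show k + 5 = (k + 3) + 1 + 1 by ring]
      simp only [PowerSeries.coeff_succ_mul_X, PowerSeries.coeff_mk]
      rw [h _ (by omega), h _ (by omega), h _ (by omega)]
      ring

/-! ## Conjugacy in `PGL_2` in terms of matrices -/

section rel

variable {R : Type*} [CommRing R]

/-- Two matrices are conjugate up to a unit scalar. -/
def Rel (A A' : Matrix (Fin 2) (Fin 2) R) : Prop :=
  ∃ (g : GL (Fin 2) R) (u : Rˣ), (g : Matrix (Fin 2) (Fin 2) R) * A = (u : R) • (A' * g)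

/-- The conjugacy class in `PGL_2` of a matrix with unit determinant. -/
def cls (A : Matrix (Fin 2) (Fin 2) R) (h : IsUnit A.det) : ConjClasses (PGL2 R) :=
  ConjClasses.mk ((Matrix.GeneralLinearGroup.mk'' A h : GL (Fin 2) R) : PGL2 R)

lemma cls_eq_iff (A A' : Matrix (Fin 2) (Fin 2) R) (h : IsUnit A.det) (h' : IsUnit A'.det) :
    cls A h = cls A' h' ↔ Rel A A' := by
  unfold cls
  rw [ConjClasses.mk_eq_mk_iff_isConj, isConj_iff]
  have hA : ((Matrix.GeneralLinearGroup.mk'' A h : GL (Fin 2) R) :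
      Matrix (Fin 2) (Fin 2) R) = A := rfl
  have hA' : ((Matrix.GeneralLinearGroup.mk'' A' h' : GL (Fin 2) R) :
      Matrix (Fin 2) (Fin 2) R) = A' := rfl
  generalize (Matrix.GeneralLinearGroup.mk'' A h : GL (Fin 2) R) = a at hA
  generalize (Matrix.GeneralLinearGroup.mk'' A' h' : GL (Fin 2) R) = b at hA'
  subst hA hA'
  constructor
  · rintro ⟨c, hc⟩
    induction c using QuotientGroup.induction_on with
    | H g =>
      have h1 : ((b : GL (Fin 2) R) : PGL2 R) = ((g * a * g⁻¹ : GL (Fin 2) R) : PGL2 R) := by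
        rw [← hc]; rfl
      rw [QuotientGroup.eq] at h1
      obtain ⟨u, hu⟩ := h1
      refine ⟨g, u, ?_⟩
      have h2 : g * a = b * (Units.map (algebraMap R (Matrix (Fin 2) (Fin 2) R)).toMonoidHom u) * g := by
        rw [hu]; group
      have h3 := congrArg (fun z : GL (Fin 2) R => (z : Matrix (Fin 2) (Fin 2) R)) h2
      simp only [Units.val_mul] at h3
      rw [h3]
      have : ((Units.map (algebraMap R (Matrix (Fin 2) (Fin 2) R)).toMonoidHom u :
          GL (Fin 2) R) : Matrix (Fin 2) (Fin 2) R) = (u : R) • 1 := by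
        rw [Units.coe_map]
        exact Algebra.algebraMap_eq_smul_one (u : R)
      rw [this]
      simp
  · rintro ⟨g, u, hg⟩
    refine ⟨(g : PGL2 R), ?_⟩
    have h1 : ((b : GL (Fin 2) R) : PGL2 R) = ((g * a * g⁻¹ : GL (Fin 2) R) : PGL2 R) := by
      rw [QuotientGroup.eq]
      refine ⟨u, ?_⟩
      have this : ((Units.map (algebraMap R (Matrix (Fin 2) (Fin 2) R)).toMonoidHom u :
          GL (Fin 2) R) : Matrix (Fin 2) (Fin 2) R) = (u : R) • 1 := by
        rw [Units.coe_map]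
        exact Algebra.algebraMap_eq_smul_one (u : R)
      have h2 : g * a = b * (Units.map (algebraMap R (Matrix (Fin 2) (Fin 2) R)).toMonoidHom u) * g := by
        apply Units.ext
        rw [Units.val_mul, hg, Units.val_mul, Units.val_mul, this]
        simp
      rw [h2]; group
    rw [h1]; rfl

lemma cls_surj (y : ConjClasses (PGL2 R)) :
    ∃ (A : Matrix (Fin 2) (Fin 2) R) (h : IsUnit A.det), cls A h = y := by
  obtain ⟨x, rfl⟩ := ConjClasses.exists_rep y
  induction x using QuotientGroup.induction_on with
  | H g =>
    refine ⟨g, (Matrix.isUnit_iff_isUnit_det _).1 g.isUnit, ?_⟩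
    unfold cls
    congr 2
    exact Units.ext rfl

/-- `c • A` is a scalar matrix. -/
def Sc (c : R) (A : Matrix (Fin 2) (Fin 2) R) : Prop :=
  ∃ s : R, c • A = s • (1 : Matrix (Fin 2) (Fin 2) R)

lemma Rel.sc {A A' : Matrix (Fin 2) (Fin 2) R} (h : Rel A A') (c : R) : Sc c A ↔ Sc c A' := by
  obtain ⟨g, u, hg⟩ := h
  have hi : ((g⁻¹ : GL (Fin 2) R) : Matrix (Fin 2) (Fin 2) R) * g = 1 := Units.inv_mul g
  have hi' : (g : Matrix (Fin 2) (Fin 2) R) * ((g⁻¹ : GL (Fin 2) R) : Matrix (Fin 2) (Fin 2) R) = 1 :=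
    Units.mul_inv g
  constructor
  · rintro ⟨s, hs⟩
    refine ⟨(↑u⁻¹ : R) * s, ?_⟩
    have h1 : A' = (↑u⁻¹ : R) • ((g : Matrix (Fin 2) (Fin 2) R) * A *
        ((g⁻¹ : GL (Fin 2) R) : Matrix (Fin 2) (Fin 2) R)) := by
      rw [hg, Matrix.smul_mul, mul_assoc, hi', smul_smul]; simp
    rw [h1, smul_comm, ← Matrix.smul_mul c, ← Matrix.mul_smul _ c, hs]
    simp [smul_smul]
  · rintro ⟨s, hs⟩
    refine ⟨u * s, ?_⟩
    have h1 : A = ((g⁻¹ : GL (Fin 2) R) : Matrix (Fin 2) (Fin 2) R) * ((u : R) • (A' * g)) := by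
      rw [← hg, ← mul_assoc, hi, one_mul]
    rw [h1, ← Matrix.mul_smul, smul_comm, ← Matrix.smul_mul, hs]
    simp [smul_smul]

end rel

/-! ## Companion matrices -/

section comp

variable {R : Type*} [CommRing R]

/-- Companion matrix with trace `t` and determinant `d`. -/
def comp (t d : R) : Matrix (Fin 2) (Fin 2) R := !![0, -d; 1, t]

@[simp] lemma det_comp (t d : R) : (comp t d).det = d := by simp [comp, Matrix.det_fin_two]
@[simp] lemma trace_comp (t d : R) : (comp t d).trace = t := by simp [comp, Matrix.trace_fin_two]

/-- A matrix which is cyclic is conjugate to a companion matrix. -/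
lemma exists_cyclic [IsLocalRing R] (a b c e : R)
    (h : IsUnit b ∨ IsUnit c ∨ IsUnit (e - a)) :
    ∃ g : GL (Fin 2) R, !![a, b; c, e] * (g : Matrix (Fin 2) (Fin 2) R) =
      (g : Matrix (Fin 2) (Fin 2) R) * comp (a + e) (a * e - b * c) := by
  have key : ∃ v w : R, IsUnit (v * (c * v + e * w) - (a * v + b * w) * w) := by
    by_cases hb : IsUnit b
    · exact ⟨0, 1, by simpa using hb⟩
    by_cases hc : IsUnit c
    · exact ⟨1, 0, by simpa using hc⟩
    · have he : IsUnit (e - a) := by tauto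
      refine ⟨1, 1, ?_⟩
      have : e - a = (1 * (c * 1 + e * 1) - (a * 1 + b * 1) * 1) + (b - c) := by ring
      rw [this] at he
      rcases IsLocalRing.isUnit_or_isUnit_of_isUnit_add he with h1 | h1
      · exact h1
      · exfalso
        rw [sub_eq_add_neg] at h1
        rcases IsLocalRing.isUnit_or_isUnit_of_isUnit_add h1 with h2 | h2
        · exact hb h2
        · exact hc (by simpa using h2)
  obtain ⟨v, w, hvw⟩ := key
  refine ⟨Matrix.GeneralLinearGroup.mk'' !![v, a * v + b * w; w, c * v + e * w] ?_, ?_⟩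
  · rw [Matrix.det_fin_two]; simpa using hvw
  · change !![a, b; c, e] * !![v, a * v + b * w; w, c * v + e * w] =
      !![v, a * v + b * w; w, c * v + e * w] * comp (a + e) (a * e - b * c)
    unfold comp
    ext i j
    fin_cases i <;> fin_cases j <;> simp [Matrix.mul_apply] <;> ring

lemma rel_comp_iff (t t' : R) (d d' : Rˣ) :
    Rel (comp t (d : R)) (comp t' (d' : R)) ↔
      ∃ u : Rˣ, t = u * t' ∧ d = u ^ 2 * d' := by
  constructor
  · rintro ⟨g, u, hg⟩
    have hi' : (g : Matrix (Fin 2) (Fin 2) R) *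
        ((g⁻¹ : GL (Fin 2) R) : Matrix (Fin 2) (Fin 2) R) = 1 := Units.mul_inv g
    have hi : ((g⁻¹ : GL (Fin 2) R) : Matrix (Fin 2) (Fin 2) R) * g = 1 := Units.inv_mul g
    have h1 : comp t (d : R) = ((g⁻¹ : GL (Fin 2) R) : Matrix (Fin 2) (Fin 2) R) *
        ((u : R) • (comp t' (d' : R) * g)) := by
      rw [← hg, ← mul_assoc, hi, one_mul]
    refine ⟨u, ?_, ?_⟩
    · have := congrArg Matrix.trace h1
      rw [Matrix.trace_mul_comm, Matrix.smul_mul, mul_assoc, hi'] at this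
      simpa using this
    · have := congrArg Matrix.det h1
      rw [Matrix.det_mul_comm, Matrix.smul_mul, mul_assoc, hi'] at this
      apply Units.ext
      simpa [Matrix.det_smul] using this
  · rintro ⟨u, rfl, rfl⟩
    refine ⟨Matrix.GeneralLinearGroup.mk'' !![1, 0; 0, (u : R)] ?_, u, ?_⟩
    · rw [Matrix.det_fin_two]; simp
    · change !![1, 0; 0, (u : R)] * _ = (u : R) • (_ * !![1, 0; 0, (u : R)])
      unfold comp
      ext i j
      fin_cases i <;> fin_cases j <;> simp [Matrix.mul_apply] <;> ring

end comp

section ext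

variable {R S : Type*} [CommRing R] [CommRing S] (π : R →+* S) (ι : S →+ R)

/-- The matrix `1 + ι (comp t d)`. -/
def emb (t d : S) : Matrix (Fin 2) (Fin 2) R := 1 + (comp t d).map ι

variable {ι π}

lemma map_mul_left (hl : ∀ r s, r * ι s = ι (π r * s)) (G : Matrix (Fin 2) (Fin 2) R)
    (B : Matrix (Fin 2) (Fin 2) S) : G * B.map ι = (G.map π * B).map ι := by
  ext i j
  simp [Matrix.mul_apply, hl]

lemma map_mul_right (hl : ∀ r s, r * ι s = ι (π r * s)) (G : Matrix (Fin 2) (Fin 2) R)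
    (B : Matrix (Fin 2) (Fin 2) S) : B.map ι * G = (B * G.map π).map ι := by
  ext i j
  simp [Matrix.mul_apply, mul_comm _ (G _ _), hl, mul_comm _ (π _)]

lemma det_emb (hl : ∀ r s, r * ι s = ι (π r * s)) (hu : ∀ s, IsUnit (1 + ι s)) (t d : S) :
    IsUnit (emb ι t d).det := by
  have : (emb ι t d).det = 1 + ι (t + π (ι 1) * d) := by
    rw [Matrix.det_fin_two]
    simp [emb, comp, ← hl]
    ring
  rw [this]
  exact hu _

lemma rel_emb_iff (hl : ∀ r s, r * ι s = ι (π r * s)) (hu : ∀ s, IsUnit (1 + ι s))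
    (hπ : Function.Surjective π) (hι : Function.Injective ι) (q : S) (hq : π (ι 1) = q)
    (t d t' d' : S) :
    Rel (emb ι t d) (emb ι t' d') ↔ ∃ x : S, t = (1 + q * x) * t' + 2 * x ∧
      d = (1 + q * x) ^ 2 * d' + (1 + q * x) * x * t' + x ^ 2 := by
  have hq' : ∀ s, π (ι s) = q * s := by
    intro s
    obtain ⟨r, rfl⟩ := hπ s
    rw [← mul_one (π r), ← hl, map_mul, hq]; ring
  constructor
  · rintro ⟨g, u, hg⟩
    set gi := ((g⁻¹ : GL (Fin 2) R) : Matrix (Fin 2) (Fin 2) R) with hgi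
    have hi' : (g : Matrix (Fin 2) (Fin 2) R) * gi = 1 := Units.mul_inv g
    have hi : gi * (g : Matrix (Fin 2) (Fin 2) R) = 1 := Units.inv_mul g
    have h1 : (g : Matrix (Fin 2) (Fin 2) R) * emb ι t d * gi = (u : R) • emb ι t' d' := by
      rw [hg, Matrix.smul_mul, mul_assoc, hi', mul_one]
    unfold emb at h1
    rw [mul_add, add_mul, mul_one, hi', map_mul_left hl, map_mul_right hl] at h1
    set M := (g : Matrix (Fin 2) (Fin 2) R).map π * comp t d * gi.map π with hM
    have hbi : gi.map π * (g : Matrix (Fin 2) (Fin 2) R).map π = 1 := by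
      rw [← Matrix.map_mul, hi]; simp
    have htr : M.trace = t := by
      rw [hM, Matrix.trace_mul_comm, ← mul_assoc, hbi, one_mul, trace_comp]
    have hdet : M.det = d := by
      rw [hM, Matrix.det_mul_comm, ← mul_assoc, hbi, one_mul, det_comp]
    have e00 := congrFun (congrFun h1 0) 0
    have e01 := congrFun (congrFun h1 0) 1
    have e10 := congrFun (congrFun h1 1) 0
    have e11 := congrFun (congrFun h1 1) 1
    simp [comp, hl] at e00 e01 e10 e11
    have hx : (u : R) = 1 + ι (M 0 0) := e00.symm
    have hpu : π u = 1 + q * M 0 0 := by rw [hx, map_add, map_one, hq']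
    have f01 : M 0 1 = -(π u * d') := hι (by rw [e01, map_neg])
    have f10 : M 1 0 = π u := hι e10
    have f11 : M 1 1 = M 0 0 + π u * t' := by
      apply hι
      rw [mul_add, hl, mul_one] at e11
      rw [map_add]
      linear_combination e11 + hx
    rw [Matrix.trace_fin_two, f11] at htr
    rw [Matrix.det_fin_two, f11, f01, f10] at hdet
    refine ⟨M 0 0, ?_, ?_⟩
    · rw [← hpu]; linear_combination -htr
    · rw [← hpu]; linear_combination -hdet
  · rintro ⟨x, rfl, rfl⟩
    obtain ⟨y, hy⟩ := hπ x
    set u := (hu x).unit with hud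
    have hux : (u : R) = 1 + ι x := rfl
    have hpu : π u = 1 + q * x := by rw [hux, map_add, map_one, hq']
    refine ⟨Matrix.GeneralLinearGroup.mk'' !![1, y; 0, (u : R)] ?_, u, ?_⟩
    · rw [Matrix.det_fin_two]; simp
    · change !![1, y; 0, (u : R)] * _ = (u : R) • (_ * !![1, y; 0, (u : R)])
      unfold emb
      rw [← hpu, Matrix.mul_add, Matrix.mul_one, Matrix.add_mul, Matrix.one_mul, map_mul_left hl,
        map_mul_right hl]
      have hgm : !![1, y; 0, (u : R)].map π = !![1, x; 0, π u] := by
        ext i j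
        fin_cases i <;> fin_cases j <;> simp [hy]
      rw [hgm]
      have hdiff : (!![1, x; 0, π u] *
          comp (π u * t' + 2 * x) (π u ^ 2 * d' + π u * x * t' + x ^ 2)) =
          !![x, x * x; 0, π u * x] + (π u • (comp t' d' * !![1, x; 0, π u])) := by
        unfold comp
        ext i j
        fin_cases i <;> fin_cases j <;> simp [Matrix.mul_apply] <;> ring
      have hsm : ∀ X : Matrix (Fin 2) (Fin 2) S, (π u • X).map ι = (u : R) • X.map ι := by
        intro X
        ext i j
        simp [hl]
      have hadd : ∀ X Y : Matrix (Fin 2) (Fin 2) S, (X + Y).map ι = X.map ι + Y.map ι := by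
        intro X Y
        ext i j
        simp
      rw [hdiff, hadd, hsm, smul_add, ← add_assoc]
      congr 1
      ext i j
      fin_cases i <;> fin_cases j
      · simp [hux]
      · simp [hux, ← hy, ← hl]; ring
      · simp
      · simp [← hl]
        linear_combination (-u : R) * hux

end ext

/-! ## Gluing -/

lemma card_glue {Y X₀ : Type*} [Finite X₀] (r₀ : X₀ → X₀ → Prop) (f₀ : X₀ → Y) (n : ℕ)
    (X : Fin n → Type) [∀ i, Finite (X i)] (r : ∀ i, X i → X i → Prop) (f : ∀ i, X i → Y)
    (h₀ : ∀ x y, f₀ x = f₀ y ↔ r₀ x y) (h : ∀ i x y, f i x = f i y ↔ r i x y)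
    (h₁ : ∀ x i y, f₀ x ≠ f i y) (h₂ : ∀ i x j y, f i x = f j y → i = j)
    (hs : ∀ y, (∃ x, f₀ x = y) ∨ ∃ i x, f i x = y) :
    Nat.card Y = Nat.card (Quot r₀) + ∑ i, Nat.card (Quot (r i)) := by
  have hfin : ∀ i, Finite (Quot (r i)) := fun i => Quot.finite _
  have hfin₀ : Finite (Quot r₀) := Quot.finite _
  rw [← Nat.card_sigma, ← Nat.card_sum]
  symm
  let F : Quot r₀ ⊕ (Σ i, Quot (r i)) → Y := Sum.elim
    (Quot.lift f₀ (fun a b hab => (h₀ a b).2 hab))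
    (fun z => Quot.lift (f z.1) (fun a b hab => (h z.1 a b).2 hab) z.2)
  refine Nat.card_congr (Equiv.ofBijective F ⟨?_, ?_⟩)
  · rintro (a | ⟨i, a⟩) (b | ⟨j, b⟩) hab
    · induction a using Quot.ind
      induction b using Quot.ind
      exact congrArg Sum.inl (Quot.sound ((h₀ _ _).1 hab))
    · induction a using Quot.ind
      induction b using Quot.ind
      exact absurd hab (h₁ _ _ _)
    · induction a using Quot.ind
      induction b using Quot.ind
      exact absurd hab.symm (h₁ _ _ _)
    · induction a using Quot.ind
      induction b using Quot.ind
      obtain rfl := h₂ _ _ _ _ hab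
      rw [Quot.sound ((h _ _ _).1 hab)]
  · intro y
    rcases hs y with ⟨x, hx⟩ | ⟨i, x, hx⟩
    · exact ⟨Sum.inl (Quot.mk _ x), hx⟩
    · exact ⟨Sum.inr ⟨i, Quot.mk _ x⟩, hx⟩

/-! ## The rings `ZMod (p ^ n)` -/

section zmod

variable (p : ℕ) [hp : Fact p.Prime]

instance neZero_pow (n : ℕ) : NeZero (p ^ n) := ⟨pow_ne_zero _ hp.out.ne_zero⟩

variable {p} in
lemma isUnit_or_dvd {n : ℕ} (x : ZMod (p ^ n)) : IsUnit x ∨ (p : ZMod (p ^ n)) ∣ x := by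
  obtain ⟨a, rfl⟩ := ZMod.natCast_zmod_surjective x
  by_cases h : p ∣ a
  · right; exact_mod_cast Nat.cast_dvd_cast h
  · left
    rw [ZMod.isUnit_iff_coprime]
    exact ((Nat.Prime.coprime_iff_not_dvd hp.out).2 h).symm.pow_right n

variable {p} in
lemma isUnit_one_add {n : ℕ} (x : ZMod (p ^ n)) : IsUnit (1 + (p : ZMod (p ^ n)) * x) := by
  apply IsNilpotent.isUnit_one_add
  refine ⟨n, ?_⟩
  rw [mul_pow]
  have : (p : ZMod (p ^ n)) ^ n = 0 := by
    have := ZMod.natCast_self (p ^ n)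
    exact_mod_cast this
  rw [this, zero_mul]

lemma p_pow_eq_zero_iff {n j : ℕ} : (p : ZMod (p ^ n)) ^ j = 0 ↔ n ≤ j := by
  rw [← Nat.cast_pow, ZMod.natCast_eq_zero_iff, Nat.pow_dvd_pow_iff_le_right hp.out.one_lt]

variable {p} in
lemma nontriv {n : ℕ} (hn : 1 ≤ n) : Nontrivial (ZMod (p ^ n)) := by
  have : Fact (1 < p ^ n) := ⟨Nat.one_lt_pow (by omega) hp.out.one_lt⟩
  infer_instance

variable {p} in
lemma localRing {n : ℕ} (hn : 1 ≤ n) : IsLocalRing (ZMod (p ^ n)) := by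
  have := nontriv (p := p) hn
  refine IsLocalRing.of_isUnit_or_isUnit_one_sub_self fun a => ?_
  rcases isUnit_or_dvd a with h | ⟨b, rfl⟩
  · exact Or.inl h
  · right
    have := isUnit_one_add (-b)
    rwa [mul_neg, ← sub_eq_add_neg] at this

/-- Multiplication by `p ^ (n - m)` as an embedding `ℤ/p^m → ℤ/p^n`. -/
def iota {m n : ℕ} (h : m ≤ n) : ZMod (p ^ m) →+ ZMod (p ^ n) :=
  ZMod.lift (p ^ m) ⟨(AddMonoidHom.mulLeft ((p : ZMod (p ^ n)) ^ (n - m))).comp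
    (Int.castAddHom (ZMod (p ^ n))), by
      simp only [AddMonoidHom.coe_comp, Function.comp_apply, Int.coe_castAddHom,
        AddMonoidHom.coe_mulLeft]
      push_cast
      rw [← pow_add, p_pow_eq_zero_iff]
      omega⟩

/-- Reduction. -/
def red {m n : ℕ} (h : m ≤ n) : ZMod (p ^ n) →+* ZMod (p ^ m) :=
  ZMod.castHom (pow_dvd_pow p h) _

lemma iota_intCast {m n : ℕ} (h : m ≤ n) (a : ℤ) :
    iota p h (a : ZMod (p ^ m)) = (p : ZMod (p ^ n)) ^ (n - m) * a := by
  unfold iota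
  rw [ZMod.lift_coe]
  rfl

lemma iota_lin {m n : ℕ} (h : m ≤ n) (r : ZMod (p ^ n)) (s : ZMod (p ^ m)) :
    r * iota p h s = iota p h (red p h r * s) := by
  obtain ⟨a, rfl⟩ := ZMod.intCast_surjective r
  obtain ⟨b, rfl⟩ := ZMod.intCast_surjective s
  rw [map_intCast (red p h), ← Int.cast_mul, iota_intCast, iota_intCast]
  push_cast
  ring

lemma iota_inj {m n : ℕ} (h : m ≤ n) : Function.Injective (iota p h) := by
  rw [injective_iff_map_eq_zero]
  intro s hs
  obtain ⟨b, rfl⟩ := ZMod.intCast_surjective s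
  rw [iota_intCast] at hs
  have h1 : (((p : ℤ) ^ (n - m) * b : ℤ) : ZMod (p ^ n)) = 0 := by push_cast; exact hs
  rw [ZMod.intCast_zmod_eq_zero_iff_dvd] at h1
  rw [ZMod.intCast_zmod_eq_zero_iff_dvd]
  obtain ⟨k, rfl⟩ := Nat.exists_eq_add_of_le h
  push_cast at h1 ⊢
  rw [Nat.add_sub_cancel_left, pow_add, mul_comm ((p : ℤ) ^ m)] at h1
  exact Int.dvd_of_mul_dvd_mul_left (pow_ne_zero _ (by exact_mod_cast hp.out.ne_zero)) h1

lemma iota_red {m n : ℕ} (h : m ≤ n) (r : ZMod (p ^ n)) :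
    iota p h (red p h r) = (p : ZMod (p ^ n)) ^ (n - m) * r := by
  obtain ⟨a, rfl⟩ := ZMod.intCast_surjective r
  rw [map_intCast (red p h), iota_intCast]

lemma red_surj {m n : ℕ} (h : m ≤ n) : Function.Surjective (red p h) :=
  ZMod.castHom_surjective _

lemma iota_unit {m n : ℕ} (h : m < n) (s : ZMod (p ^ m)) : IsUnit (1 + iota p h.le s) := by
  obtain ⟨r, rfl⟩ := red_surj p h.le s
  rw [iota_red, show n - m = (n - m - 1) + 1 by omega, pow_succ', mul_assoc]
  exact isUnit_one_add _

lemma red_iota_one {m n : ℕ} (h : m ≤ n) :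
    red p h (iota p h 1) = (p : ZMod (p ^ m)) ^ (n - m) := by
  rw [← map_one (red p h), iota_red]
  simp

lemma factor {n : ℕ} (b c f : ZMod (p ^ n)) : ∃ k ≤ n, ∃ b' c' f' : ZMod (p ^ n),
    b = (p : ZMod (p ^ n)) ^ k * b' ∧ c = (p : ZMod (p ^ n)) ^ k * c' ∧
    f = (p : ZMod (p ^ n)) ^ k * f' ∧ (IsUnit b' ∨ IsUnit c' ∨ IsUnit f') := by
  classical
  let P : ℕ → Prop := fun k => (p : ZMod (p ^ n)) ^ k ∣ b ∧ (p : ZMod (p ^ n)) ^ k ∣ c ∧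
    (p : ZMod (p ^ n)) ^ k ∣ f
  have hP : P (Nat.findGreatest P n) :=
    Nat.findGreatest_spec (m := 0) (Nat.zero_le _) ⟨by simp, by simp, by simp⟩
  have hle : Nat.findGreatest P n ≤ n := Nat.findGreatest_le n
  have hmax : ∀ k, Nat.findGreatest P n < k → k ≤ n → ¬ P k := fun k h1 h2 =>
    Nat.findGreatest_is_greatest h1 h2
  generalize Nat.findGreatest P n = k at hP hle hmax
  obtain ⟨⟨b', hb⟩, ⟨c', hc⟩, ⟨f', hf⟩⟩ := hP
  rcases hle.eq_or_lt with rfl | hlt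
  · have h0 : (p : ZMod (p ^ k)) ^ k = 0 := (p_pow_eq_zero_iff p).2 le_rfl
    exact ⟨k, le_rfl, 1, 1, 1, by simp [hb, h0], by simp [hc, h0], by simp [hf, h0], by simp⟩
  · refine ⟨k, hle, b', c', f', hb, hc, hf, ?_⟩
    by_contra hcon
    push Not at hcon
    obtain ⟨h1, h2, h3⟩ := hcon
    have h1 := (isUnit_or_dvd b').resolve_left h1
    have h2 := (isUnit_or_dvd c').resolve_left h2
    have h3 := (isUnit_or_dvd f').resolve_left h3
    refine hmax (k + 1) (by omega) (by omega) ⟨?_, ?_, ?_⟩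
    · rw [hb, pow_succ]; exact mul_dvd_mul_left _ h1
    · rw [hc, pow_succ]; exact mul_dvd_mul_left _ h2
    · rw [hf, pow_succ]; exact mul_dvd_mul_left _ h3

lemma Rel.of_inv {R : Type*} [CommRing R] {A A' : Matrix (Fin 2) (Fin 2) R}
    (g : GL (Fin 2) R) (u : Rˣ)
    (h : A * (g : Matrix (Fin 2) (Fin 2) R) = (u : R) • ((g : Matrix (Fin 2) (Fin 2) R) * A')) :
    Rel A A' := by
  refine ⟨g⁻¹, u, ?_⟩
  have hi' : (g : Matrix (Fin 2) (Fin 2) R) *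
      ((g⁻¹ : GL (Fin 2) R) : Matrix (Fin 2) (Fin 2) R) = 1 := Units.mul_inv g
  have hi : ((g⁻¹ : GL (Fin 2) R) : Matrix (Fin 2) (Fin 2) R) * g = 1 := Units.inv_mul g
  have h1 : A = ((u : R) • ((g : Matrix (Fin 2) (Fin 2) R) * A')) *
      ((g⁻¹ : GL (Fin 2) R) : Matrix (Fin 2) (Fin 2) R) := by
    rw [← h, mul_assoc, hi', mul_one]
  rw [h1, Matrix.smul_mul, Matrix.mul_smul, mul_assoc, ← mul_assoc, hi, one_mul]

lemma cover {n : ℕ} (hn : 1 ≤ n) (A : Matrix (Fin 2) (Fin 2) (ZMod (p ^ n)))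
    (hA : IsUnit A.det) :
    (∃ (t : ZMod (p ^ n)) (d : (ZMod (p ^ n))ˣ), Rel A (comp t (d : ZMod (p ^ n)))) ∨
    ∃ (m : ℕ) (h : m < n) (t d : ZMod (p ^ m)), Rel A (emb (iota p h.le) t d) := by
  have := localRing (p := p) hn
  obtain ⟨a, b, c, e, rfl⟩ : ∃ a b c e, A = !![a, b; c, e] :=
    ⟨A 0 0, A 0 1, A 1 0, A 1 1, Matrix.eta_fin_two A⟩
  have hdet : (!![a, b; c, e] : Matrix (Fin 2) (Fin 2) (ZMod (p ^ n))).det = a * e - b * c := by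
    rw [Matrix.det_fin_two]; simp
  rw [hdet] at hA
  obtain ⟨k, hk, b', c', f', hb, hc, hf, hunit⟩ := factor p b c (e - a)
  rcases Nat.eq_zero_or_pos k with rfl | hkpos
  · left
    simp only [pow_zero, one_mul] at hb hc hf
    subst hb hc hf
    obtain ⟨g, hg⟩ := exists_cyclic a b c e hunit
    refine ⟨a + e, hA.unit, Rel.of_inv g 1 ?_⟩
    rw [hg]
    simp
  · right
    have ha : IsUnit a := by
      rcases isUnit_or_dvd a with h | ⟨a', ha'⟩
      · exact h
      · exfalso
        have h1 : ∃ z, a * e - b * c = p * z := by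
          refine ⟨a' * e - p ^ (k - 1) * b' * c, ?_⟩
          rw [ha', hb, show k = (k - 1) + 1 by omega, pow_succ']
          simp only [Nat.add_sub_cancel]
          ring
        obtain ⟨z, hz⟩ := h1
        rw [hz] at hA
        have h2 := isUnit_of_mul_isUnit_left hA
        have h3 := h2.pow n
        rw [(p_pow_eq_zero_iff p).2 le_rfl] at h3
        exact not_isUnit_zero h3
    obtain ⟨v, rfl⟩ := ha
    obtain ⟨g, hg⟩ := exists_cyclic (0 : ZMod (p ^ n)) ((↑v⁻¹ : ZMod (p ^ n)) * b')
      ((↑v⁻¹ : ZMod (p ^ n)) * c') ((↑v⁻¹ : ZMod (p ^ n)) * f') (by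
        rw [sub_zero]
        rcases hunit with h | h | h
        · exact Or.inl (v⁻¹.isUnit.mul h)
        · exact Or.inr (Or.inl (v⁻¹.isUnit.mul h))
        · exact Or.inr (Or.inr (v⁻¹.isUnit.mul h)))
    have hmn : n - k < n := by omega
    generalize (0 + ↑v⁻¹ * f' : ZMod (p ^ n)) = t at hg
    generalize (0 * (↑v⁻¹ * f') - ↑v⁻¹ * b' * (↑v⁻¹ * c') : ZMod (p ^ n)) = d at hg
    refine ⟨n - k, hmn, red p hmn.le t, red p hmn.le d, Rel.of_inv g v ?_⟩
    have hE : emb (iota p hmn.le) (red p hmn.le t) (red p hmn.le d) =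
        1 + (p : ZMod (p ^ n)) ^ k • comp t d := by
      have hkk : n - (n - k) = k := by omega
      unfold emb
      congr 1
      have : comp (red p hmn.le t) (red p hmn.le d) = (comp t d).map (red p hmn.le) := by
        unfold comp
        ext i j
        fin_cases i <;> fin_cases j <;> simp
      rw [this]
      ext i j
      simp only [Matrix.map_apply, iota_red, hkk, Matrix.smul_apply, smul_eq_mul]
    rw [hE, mul_add, mul_one, Matrix.mul_smul, ← hg, ← Matrix.smul_mul]
    have hAA : !![(v : ZMod (p ^ n)), b; c, e] = (v : ZMod (p ^ n)) •
        (1 + (p : ZMod (p ^ n)) ^ k • !![0, ↑v⁻¹ * b'; ↑v⁻¹ * c', ↑v⁻¹ * f']) := by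
      have hvv : (v : ZMod (p ^ n)) * (↑v⁻¹ : ZMod (p ^ n)) = 1 := Units.mul_inv v
      ext i j
      fin_cases i <;> fin_cases j
      · simp
      · simp [hb]; linear_combination (-(p : ZMod (p ^ n)) ^ k * b') * hvv
      · simp [hc]; linear_combination (-(p : ZMod (p ^ n)) ^ k * c') * hvv
      · simp; linear_combination (-(p : ZMod (p ^ n)) ^ k * f') * hvv + hf
    rw [hAA, Matrix.smul_mul, add_mul, one_mul]

/-- The relation on (trace, determinant) pairs for classes of depth at least one. -/
def relK {S : Type} [CommRing S] (q : S) (a b : S × S) : Prop :=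
  ∃ x : S, a.1 = (1 + q * x) * b.1 + 2 * x ∧
      a.2 = (1 + q * x) ^ 2 * b.2 + (1 + q * x) * x * b.1 + x ^ 2

/-- The relation on (trace, determinant) pairs for classes of depth zero. -/
def rel0 {R : Type} [CommRing R] (a b : R × Rˣ) : Prop :=
  ∃ u : Rˣ, a.1 = u * b.1 ∧ a.2 = u ^ 2 * b.2

lemma sc_emb {m n : ℕ} (h : m ≤ n) (t d : ZMod (p ^ m)) (j : ℕ) :
    Sc ((p : ZMod (p ^ n)) ^ j) (emb (iota p h) t d) ↔ m ≤ j := by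
  constructor
  · rintro ⟨s, hs⟩
    have := congrFun (congrFun hs 1) 0
    simp [emb, comp, iota_lin] at this
    rw [map_eq_zero_iff _ (iota_inj p h)] at this
    exact (p_pow_eq_zero_iff p).1 this
  · intro hj
    refine ⟨p ^ j, ?_⟩
    have h0 : (p : ZMod (p ^ m)) ^ j = 0 := (p_pow_eq_zero_iff p).2 hj
    unfold emb
    rw [smul_add]
    convert add_zero _
    ext i k
    simp [iota_lin, h0]

lemma sc_comp {n : ℕ} (t d : ZMod (p ^ n)) (j : ℕ)
    (hs : Sc ((p : ZMod (p ^ n)) ^ j) (comp t d)) : n ≤ j := by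
  obtain ⟨s, hs⟩ := hs
  have := congrFun (congrFun hs 1) 0
  simp [comp] at this
  exact (p_pow_eq_zero_iff p).1 this

theorem card_classes {n : ℕ} (hn : 1 ≤ n) :
    Nat.card (ConjClasses (PGL2 (ZMod (p ^ n)))) =
      Nat.card (Quot (rel0 (R := ZMod (p ^ n)))) +
      ∑ m ∈ Finset.range n, Nat.card (Quot (relK ((p : ZMod (p ^ m)) ^ (n - m)))) := by
  rw [← Fin.sum_univ_eq_sum_range (fun m => Nat.card (Quot (relK ((p : ZMod (p ^ m)) ^ (n - m))))) n]
  refine card_glue rel0 (fun x => cls (comp x.1 (x.2 : ZMod (p ^ n))) (by simp)) n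
    (fun i => ZMod (p ^ (i : ℕ)) × ZMod (p ^ (i : ℕ)))
    (fun i => relK ((p : ZMod (p ^ (i : ℕ))) ^ (n - i)))
    (fun i x => cls (emb (iota p i.2.le) x.1 x.2) (det_emb (iota_lin p i.2.le) (iota_unit p i.2) _ _))
    ?_ ?_ ?_ ?_ ?_
  · intro x y
    rw [cls_eq_iff, rel_comp_iff]
    rfl
  · intro i x y
    rw [cls_eq_iff, rel_emb_iff (iota_lin p i.2.le) (iota_unit p i.2) (red_surj p _) (iota_inj p _) _
      (red_iota_one p _)]
    rfl
  · intro x i y hxy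
    rw [cls_eq_iff] at hxy
    have h1 := (hxy.sc (p ^ (i : ℕ))).2 ((sc_emb p i.2.le y.1 y.2 i).2 le_rfl)
    have := sc_comp p _ _ _ h1
    omega
  · intro i x j y hxy
    rw [cls_eq_iff] at hxy
    have h1 := (hxy.sc (p ^ (j : ℕ))).2 ((sc_emb p j.2.le y.1 y.2 j).2 le_rfl)
    have h2 := (hxy.sc (p ^ (i : ℕ))).1 ((sc_emb p i.2.le x.1 x.2 i).2 le_rfl)
    rw [sc_emb] at h1 h2
    exact Fin.ext (le_antisymm h1 h2)
  · intro y
    obtain ⟨A, hA, rfl⟩ := cls_surj y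
    rcases cover p hn A hA with ⟨t, d, h⟩ | ⟨m, hm, t, d, h⟩
    · left
      exact ⟨(t, d), ((cls_eq_iff _ _ _ _).2 h).symm⟩
    · right
      exact ⟨⟨m, hm⟩, (t, d), ((cls_eq_iff _ _ _ _).2 h).symm⟩

end zmod

/-! ## Burnside counts -/

section burnside

/-- Burnside's lemma for a relation which is an orbit relation. -/
lemma burnside {G X : Type} [Group G] [Fintype G] [Finite X] [MulAction G X]
    (r : X → X → Prop) (h : ∀ a b, r a b ↔ ∃ g : G, g • b = a) :
    Nat.card (Quot r) * Nat.card G = ∑ g : G, Nat.card {a : X // g • a = a} := by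
  classical
  have hX := Fintype.ofFinite X
  have hQ := Fintype.ofFinite (MulAction.orbitRel.Quotient G X)
  have h1 := MulAction.sum_card_fixedBy_eq_card_orbits_mul_card_group G X
  have h2 : Nat.card (Quot r) = Nat.card (MulAction.orbitRel.Quotient G X) :=
    Nat.card_congr (Quot.congrRight (fun a b => h a b))
  rw [h2, Nat.card_eq_fintype_card, Nat.card_eq_fintype_card, ← h1]
  refine Finset.sum_congr rfl fun g _ => ?_
  rw [Nat.card_eq_fintype_card]
  rfl

/-- Pairs (trace, determinant) with unit determinant. -/
def X0 (R : Type) [CommRing R] : Type := R × Rˣ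

instance actX0 (R : Type) [CommRing R] : MulAction Rˣ (X0 R) where
  smul u a := ((u : R) * a.1, u ^ 2 * a.2)
  one_smul a := by
    refine Prod.ext ?_ ?_
    · change ((1 : Rˣ) : R) * a.1 = a.1
      rw [Units.val_one, one_mul]
    · change (1 : Rˣ) ^ 2 * a.2 = a.2
      rw [one_pow, one_mul]
  mul_smul u v a := by
    change (((u * v : Rˣ) : R) * a.1, (u * v) ^ 2 * a.2) = ((u : R) * ((v : R) * a.1), u ^ 2 * (v ^ 2 * a.2))
    rw [Units.val_mul, mul_assoc, mul_pow, mul_assoc]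

lemma card_rel0 (R : Type) [CommRing R] [Fintype R] [DecidableEq R] :
    Nat.card (Quot (rel0 (R := R))) =
      ∑ u : Rˣ, if u ^ 2 = 1 then Nat.card {t : R // (u : R) * t = t} else 0 := by
  have hfin : Finite (X0 R) := inferInstanceAs (Finite (R × Rˣ))
  have h1 := burnside (G := Rˣ) (X := X0 R) rel0 (by
    intro a b
    refine exists_congr fun u => ?_
    exact ⟨fun h => Prod.ext h.1.symm h.2.symm,
      fun h => ⟨(congrArg Prod.fst h).symm, (congrArg Prod.snd h).symm⟩⟩)
  have h2 : ∀ u : Rˣ, Nat.card {a : X0 R // u • a = a} =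
      (if u ^ 2 = 1 then Nat.card {t : R // (u : R) * t = t} else 0) * Nat.card Rˣ := by
    intro u
    split_ifs with hu
    · rw [← Nat.card_prod]
      refine Nat.card_congr ⟨fun a => (⟨a.1.1, congrArg Prod.fst a.2⟩, a.1.2),
        fun b => ⟨(b.1.1, b.2), ?_⟩, fun a => rfl, fun b => rfl⟩
      change ((u : R) * b.1.1, u ^ 2 * b.2) = (b.1.1, b.2)
      rw [b.1.2, hu, one_mul]
    · rw [zero_mul]
      have : IsEmpty {a : X0 R // u • a = a} := by
        refine ⟨fun a => hu ?_⟩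
        have := congrArg Prod.snd a.2
        change u ^ 2 * a.1.2 = a.1.2 at this
        exact mul_eq_right.1 this
      exact Nat.card_of_isEmpty
  simp_rw [h2] at h1
  rw [← Finset.sum_mul] at h1
  exact Nat.eq_of_mul_eq_mul_right Nat.card_pos h1

/-- The group of affine maps `b ↦ (1 + q x) b + x`. -/
structure HGrp (S : Type) [CommRing S] (q : S) (hq : ∀ x : S, IsUnit (1 + q * x)) where
  val : S

variable {S : Type} [CommRing S] {q : S} {hq : ∀ x : S, IsUnit (1 + q * x)}

/-- Underlying equivalence. -/
def hEquiv (S : Type) [CommRing S] (q : S) (hq : ∀ x : S, IsUnit (1 + q * x)) : HGrp S q hq ≃ S :=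
  ⟨HGrp.val, HGrp.mk, fun _ => rfl, fun _ => rfl⟩

lemma hgrp_inv_spec (hq : ∀ x : S, IsUnit (1 + q * x)) (x : S) :
    (1 + q * x) * (((hq x).unit⁻¹ : Sˣ) : S) = 1 := (hq x).mul_val_inv

instance hgrp_mul : Mul (HGrp S q hq) := ⟨fun x y => ⟨x.val + y.val + q * x.val * y.val⟩⟩
instance hgrp_inv : Inv (HGrp S q hq) := ⟨fun x => ⟨-x.val * (((hq x.val).unit⁻¹ : Sˣ) : S)⟩⟩
instance hgrp_one : One (HGrp S q hq) := ⟨⟨0⟩⟩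

instance hgrp_group : Group (HGrp S q hq) := Group.ofLeftAxioms (G := HGrp S q hq)
  (by
    rintro ⟨x⟩ ⟨y⟩ ⟨z⟩
    refine congrArg HGrp.mk ?_
    change (x + y + q * x * y) + z + q * (x + y + q * x * y) * z =
      x + (y + z + q * y * z) + q * x * (y + z + q * y * z)
    ring)
  (by
    rintro ⟨x⟩
    refine congrArg HGrp.mk ?_
    change 0 + x + q * 0 * x = x
    ring)
  (by
    rintro ⟨x⟩
    refine congrArg HGrp.mk ?_
    have := hgrp_inv_spec hq x
    change (-x * (((hq x).unit⁻¹ : Sˣ) : S)) + x +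
      q * (-x * (((hq x).unit⁻¹ : Sˣ) : S)) * x = 0
    linear_combination (-x) * this)

instance hgrp_act : MulAction (HGrp S q hq) (S × S) where
  smul x b := ((1 + q * x.val) * b.1 + 2 * x.val,
    (1 + q * x.val) ^ 2 * b.2 + (1 + q * x.val) * x.val * b.1 + x.val ^ 2)
  one_smul b := by
    change ((1 + q * (0 : S)) * b.1 + 2 * 0,
      (1 + q * (0 : S)) ^ 2 * b.2 + (1 + q * 0) * 0 * b.1 + 0 ^ 2) = b
    ext <;> simp
  mul_smul x y b := by
    refine Prod.ext ?_ ?_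
    · change (1 + q * (x.val + y.val + q * x.val * y.val)) * b.1 +
        2 * (x.val + y.val + q * x.val * y.val) =
        (1 + q * x.val) * ((1 + q * y.val) * b.1 + 2 * y.val) + 2 * x.val
      ring
    · change (1 + q * (x.val + y.val + q * x.val * y.val)) ^ 2 * b.2 +
        (1 + q * (x.val + y.val + q * x.val * y.val)) * (x.val + y.val + q * x.val * y.val) * b.1 +
        (x.val + y.val + q * x.val * y.val) ^ 2 =
        (1 + q * x.val) ^ 2 * ((1 + q * y.val) ^ 2 * b.2 + (1 + q * y.val) * y.val * b.1 + y.val ^ 2)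
        + (1 + q * x.val) * x.val * ((1 + q * y.val) * b.1 + 2 * y.val) + x.val ^ 2
      ring

/-- The fixed point condition. -/
def Fixd (q x : S) (a : S × S) : Prop :=
  x * (2 + q * a.1) = 0 ∧
    q * x * (2 + q * x) * a.2 + (1 + q * x) * x * a.1 + x ^ 2 = 0

lemma card_relK [Fintype S] (q : S) (hq : ∀ x : S, IsUnit (1 + q * x)) :
    Nat.card (Quot (relK q)) * Nat.card S =
      ∑ x : S, Nat.card {a : S × S // Fixd q x a} := by
  have : Fintype (HGrp S q hq) := Fintype.ofEquiv _ (hEquiv S q hq).symm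
  have h1 := burnside (G := HGrp S q hq) (X := S × S) (relK q) (by
    intro a b
    constructor
    · rintro ⟨x, h1, h2⟩
      exact ⟨⟨x⟩, Prod.ext h1.symm h2.symm⟩
    · rintro ⟨x, rfl⟩
      exact ⟨x.val, rfl, rfl⟩)
  rw [Nat.card_congr (hEquiv S q hq)] at h1
  rw [h1]
  refine Fintype.sum_equiv (hEquiv S q hq) _ _ fun x => ?_
  refine Nat.card_congr (Equiv.subtypeEquivRight fun a => ?_)
  change ((1 + q * x.val) * a.1 + 2 * x.val,
    (1 + q * x.val) ^ 2 * a.2 + (1 + q * x.val) * x.val * a.1 + x.val ^ 2) = a ↔ Fixd q x.val a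
  rw [Prod.ext_iff]
  unfold Fixd
  refine and_congr ?_ ?_
  · rw [← sub_eq_zero]
    refine Eq.congr ?_ rfl
    ring
  · rw [← sub_eq_zero]
    refine Eq.congr ?_ rfl
    ring

end burnside

/-! ## Annihilators -/

section ann

variable (p : ℕ) [hp : Fact p.Prime]

lemma ann_iff {m n : ℕ} (h : m ≤ n) (x : ZMod (p ^ n)) :
    (p : ZMod (p ^ n)) ^ m * x = 0 ↔ ∃ s, iota p h s = x := by
  constructor
  · intro hx
    obtain ⟨a, rfl⟩ := ZMod.intCast_surjective x
    have h1 : (((p : ℤ) ^ m * a : ℤ) : ZMod (p ^ n)) = 0 := by push_cast; exact hx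
    rw [ZMod.intCast_zmod_eq_zero_iff_dvd] at h1
    push_cast at h1
    rw [show n = m + (n - m) by omega, pow_add] at h1
    obtain ⟨b, hb⟩ := Int.dvd_of_mul_dvd_mul_left
      (pow_ne_zero _ (by exact_mod_cast hp.out.ne_zero)) h1
    refine ⟨(b : ZMod (p ^ m)), ?_⟩
    rw [iota_intCast, hb]
    push_cast
    rfl
  · rintro ⟨s, rfl⟩
    rw [iota_lin, map_pow, map_natCast, (p_pow_eq_zero_iff p).2 le_rfl, zero_mul, map_zero]

lemma card_ann {m n : ℕ} (h : m ≤ n) :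
    Nat.card {x : ZMod (p ^ n) // (p : ZMod (p ^ n)) ^ m * x = 0} = p ^ m := by
  have h1 : Nat.card {x : ZMod (p ^ n) // (p : ZMod (p ^ n)) ^ m * x = 0} =
      Nat.card (Set.range (iota p h)) :=
    Nat.card_congr (Equiv.subtypeEquivRight fun x => ann_iff p h x)
  rw [h1, Nat.card_range_of_injective (iota_inj p h), Nat.card_zmod]

end ann

lemma card_univ_sub {α : Type*} (P : α → Prop) (h : ∀ a, P a) :
    Nat.card {a // P a} = Nat.card α := Nat.card_congr (Equiv.subtypeUnivEquiv h)

lemma card_empty_sub {α : Type*} (P : α → Prop) (h : ∀ a, ¬ P a) :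
    Nat.card {a // P a} = 0 := by
  have : IsEmpty {a // P a} := ⟨fun a => h _ a.2⟩
  exact Nat.card_of_isEmpty

lemma card_fst_sub {α β : Type*} (P : α → Prop) :
    Nat.card {a : α × β // P a.1} = Nat.card {a // P a} * Nat.card β := by
  rw [← Nat.card_prod]
  exact Nat.card_congr ⟨fun a => (⟨a.1.1, a.2⟩, a.1.2), fun b => ⟨(b.1.1, b.2), b.1.2⟩,
    fun _ => rfl, fun _ => rfl⟩

lemma card_congr_sub {α : Type*} (P Q : α → Prop) (h : ∀ a, P a ↔ Q a) :
    Nat.card {a // P a} = Nat.card {a // Q a} := Nat.card_congr (Equiv.subtypeEquivRight h)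

section odd

variable (p : ℕ) [hp : Fact p.Prime]

lemma isUnit_one_add_pow {m k : ℕ} (hk : 1 ≤ k) (x : ZMod (p ^ m)) :
    IsUnit (1 + (p : ZMod (p ^ m)) ^ k * x) := by
  rw [show k = (k - 1) + 1 by omega, pow_succ', mul_assoc]
  exact isUnit_one_add _

lemma isUnit_two (h2 : p ≠ 2) (n : ℕ) : IsUnit (2 : ZMod (p ^ n)) := by
  have : IsUnit ((2 : ℕ) : ZMod (p ^ n)) := by
    rw [ZMod.isUnit_iff_coprime]
    apply Nat.Coprime.pow_right
    exact (Nat.coprime_primes Nat.prime_two hp.out).2 (Ne.symm h2)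
  simpa using this

lemma card_relK_odd (h2 : p ≠ 2) {m k : ℕ} (hk : 1 ≤ k) :
    Nat.card (Quot (relK ((p : ZMod (p ^ m)) ^ k))) = p ^ m := by
  have h1 := card_relK ((p : ZMod (p ^ m)) ^ k) (isUnit_one_add_pow p hk)
  have hfix : ∀ (x : ZMod (p ^ m)) (a : ZMod (p ^ m) × ZMod (p ^ m)),
      Fixd ((p : ZMod (p ^ m)) ^ k) x a ↔ x = 0 := by
    intro x a
    unfold Fixd
    constructor
    · rintro ⟨h, -⟩
      obtain ⟨w, hw⟩ := isUnit_two p h2 m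
      have hu : IsUnit (2 + (p : ZMod (p ^ m)) ^ k * a.1) := by
        have h3 := w.isUnit.mul (isUnit_one_add_pow p hk ((↑w⁻¹ : ZMod (p ^ m)) * a.1))
        convert h3 using 1
        have : (w : ZMod (p ^ m)) * (↑w⁻¹ : ZMod (p ^ m)) = 1 := Units.mul_inv w
        rw [← hw]
        linear_combination (-(p : ZMod (p ^ m)) ^ k * a.1) * this
      exact (hu.mul_left_eq_zero).1 h
    · rintro rfl
      simp
  simp_rw [hfix] at h1
  rw [Fintype.sum_eq_single 0] at h1
  · rw [card_univ_sub _ (fun _ => by simp), Nat.card_prod, Nat.card_zmod] at h1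
    exact Nat.eq_of_mul_eq_mul_right (pow_pos hp.out.pos m) h1
  · intro x hx
    simp [hx]

lemma card_rel0_odd (h2 : p ≠ 2) {n : ℕ} (hn : 1 ≤ n) :
    Nat.card (Quot (rel0 (R := ZMod (p ^ n)))) = p ^ n + 1 := by
  have := nontriv (p := p) hn
  have h2u := isUnit_two p h2 n
  have hloc := localRing (p := p) hn
  have hsq : ∀ u : (ZMod (p ^ n))ˣ, u ^ 2 = 1 ↔ u = 1 ∨ u = -1 := by
    intro u
    constructor
    · intro h
      have h' : (u : ZMod (p ^ n)) ^ 2 = 1 := by rw [← Units.val_pow_eq_pow_val, h, Units.val_one]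
      have h3 : (1 + (u : ZMod (p ^ n))) * (1 - u) = 0 := by linear_combination -h'
      have h4 : IsUnit ((1 + (u : ZMod (p ^ n))) + (1 - u)) := by
        convert h2u using 1; ring
      rcases IsLocalRing.isUnit_or_isUnit_of_isUnit_add h4 with h5 | h5
      · left
        apply Units.ext
        rw [h5.mul_right_eq_zero] at h3
        rw [Units.val_one]
        linear_combination -h3
      · right
        apply Units.ext
        rw [h5.mul_left_eq_zero] at h3
        rw [Units.val_neg, Units.val_one]
        linear_combination h3
    · rintro (rfl | rfl) <;> simp
  have hne : (1 : (ZMod (p ^ n))ˣ) ≠ -1 := by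
    intro h
    have h' := congrArg (fun z : (ZMod (p ^ n))ˣ => (z : ZMod (p ^ n))) h
    simp only [Units.val_one, Units.val_neg] at h'
    have : (2 : ZMod (p ^ n)) = 0 := by linear_combination h'
    rw [this] at h2u
    exact not_isUnit_zero h2u
  rw [card_rel0, Fintype.sum_eq_add 1 (-1) hne]
  · rw [if_pos (by simp), if_pos (by simp)]
    congr 1
    · simp [Nat.card_congr (Equiv.subtypeUnivEquiv
        (p := fun _ : ZMod (p ^ n) => True) (fun _ => trivial))]
    · rw [Nat.card_eq_one_iff_unique]
      have hz : ∀ t : {t : ZMod (p ^ n) // ((-1 : (ZMod (p ^ n))ˣ) : ZMod (p ^ n)) * t = t}, t.1 = 0 := by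
        rintro ⟨t, ht⟩
        rw [Units.val_neg, Units.val_one] at ht
        have h5 : 2 * t = 0 := by linear_combination -ht
        exact h2u.mul_right_eq_zero.1 h5
      exact ⟨⟨fun a b => Subtype.ext ((hz a).trans (hz b).symm)⟩, ⟨⟨0, by simp⟩⟩⟩
  · intro u hu
    rw [if_neg]
    rw [hsq]
    tauto

end odd

section two

lemma pow2_eq_zero_iff {n j : ℕ} : (2 : ZMod (2 ^ n)) ^ j = 0 ↔ n ≤ j := by
  have := p_pow_eq_zero_iff 2 (n := n) (j := j)
  simpa using this

lemma isUnit_one_add_pow2 {m k : ℕ} (hk : 1 ≤ k) (x : ZMod (2 ^ m)) :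
    IsUnit (1 + (2 : ZMod (2 ^ m)) ^ k * x) := by
  have := isUnit_one_add_pow 2 hk x
  simpa using this

lemma isUnit_one_add_two {m : ℕ} (x : ZMod (2 ^ m)) :
    IsUnit (1 + (2 : ZMod (2 ^ m)) * x) := by
  have := isUnit_one_add_pow2 le_rfl x
  simpa using this

lemma unit_or_even {n : ℕ} (x : ZMod (2 ^ n)) : IsUnit x ∨ ∃ y, x = 2 * y := by
  have := isUnit_or_dvd (p := 2) x
  rcases this with h | ⟨y, hy⟩
  · exact Or.inl h
  · exact Or.inr ⟨y, by simpa using hy⟩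

lemma card_ann2 {m n : ℕ} (h : m ≤ n) :
    Nat.card {x : ZMod (2 ^ n) // (2 : ZMod (2 ^ n)) ^ m * x = 0} = 2 ^ m := by
  have := card_ann 2 h
  simpa using this

lemma ann_two {n : ℕ} (x : ZMod (2 ^ (n + 1))) : 2 * x = 0 ↔ x = 0 ∨ x = 2 ^ n := by
  constructor
  · intro h
    have h1 := (ann_iff 2 (m := 1) (n := n + 1) (by omega) x).1 (by simpa using h)
    obtain ⟨s, rfl⟩ := h1
    have : ∀ s : ZMod (2 ^ 1), s = 0 ∨ s = ((1 : ℤ) : ZMod (2 ^ 1)) := by decide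
    rcases this s with rfl | rfl
    · left; simp
    · right; rw [iota_intCast]; simp
  · rintro (rfl | rfl)
    · simp
    · rw [← pow_succ']; exact pow2_eq_zero_iff.2 le_rfl

/-- Depth at least two. -/
lemma card_relK_two (M k : ℕ) :
    Nat.card (Quot (relK ((2 : ZMod (2 ^ (M + 1))) ^ (k + 2)))) = 3 * 2 ^ M := by
  set q : ZMod (2 ^ (M + 1)) := 2 ^ (k + 2) with hq
  set h : ZMod (2 ^ (M + 1)) := 2 ^ M with hh
  have h1 := card_relK q (isUnit_one_add_pow2 (by omega))
  have hh2 : 2 * h = 0 := (ann_two h).2 (Or.inr rfl)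
  have hh0 : h ≠ 0 := by
    rw [hh, Ne, pow2_eq_zero_iff]; omega
  have hfix : ∀ (x : ZMod (2 ^ (M + 1))) (a : ZMod (2 ^ (M + 1)) × ZMod (2 ^ (M + 1))),
      Fixd q x a ↔ x = 0 ∨ (x = h ∧ h * (a.1 + h) = 0) := by
    intro x a
    have hqh : q * h = 0 := by
      rw [hq]; linear_combination (2 ^ (k + 1) : ZMod (2 ^ (M + 1))) * hh2
    unfold Fixd
    constructor
    · rintro ⟨e1, e2⟩
      have e3 : (2 * x) * (1 + 2 ^ (k + 1) * a.1) = 0 := by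
        rw [← e1, hq]; ring
      rw [(isUnit_one_add_pow2 (by omega) a.1).mul_left_eq_zero, ann_two] at e3
      rcases e3 with rfl | rfl
      · left; rfl
      · right
        rw [← hh] at e2 ⊢
        refine ⟨rfl, ?_⟩
        linear_combination e2 - ((2 + q * h) * a.2 + h * a.1) * hqh
    · rintro (rfl | ⟨rfl, e⟩)
      · simp
      · constructor
        · linear_combination hh2 + a.1 * hqh
        · linear_combination e + ((2 + q * h) * a.2 + h * a.1) * hqh
  rw [Fintype.sum_eq_add 0 h hh0.symm] at h1
  · rw [card_univ_sub _ (fun a => (hfix 0 a).2 (Or.inl rfl)),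
      card_congr_sub _ (fun a => h * (a.1 + h) = 0) (fun a => by rw [hfix]; simp [hh0]),
      card_fst_sub (fun t => h * (t + h) = 0)] at h1
    have h3 : Nat.card {t : ZMod (2 ^ (M + 1)) // h * (t + h) = 0} = 2 ^ M := by
      rw [← card_ann2 (m := M) (n := M + 1) (by omega)]
      exact Nat.card_congr ((Equiv.addRight h).subtypeEquiv fun a => Iff.rfl)
    rw [h3, Nat.card_prod, Nat.card_zmod, ← add_mul] at h1
    rw [Nat.eq_of_mul_eq_mul_right (by positivity) h1]
    ring
  · rintro x ⟨hx1, hx2⟩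
    exact card_empty_sub _ (fun a => by rw [hfix]; tauto)

/-- Depth one. -/
lemma card_relK_one (M : ℕ) :
    Nat.card (Quot (relK ((2 : ZMod (2 ^ (M + 2))) ^ 1))) = 3 * 2 ^ (M + 1) + 2 := by
  rw [pow_one]
  set h : ZMod (2 ^ (M + 2)) := 2 ^ (M + 1) with hh
  have h1 := card_relK (2 : ZMod (2 ^ (M + 2))) isUnit_one_add_two
  have hh2 : 2 * h = 0 := (ann_two h).2 (Or.inr rfl)
  have hhh : h * h = 0 := by
    rw [hh, ← pow_add, pow2_eq_zero_iff]; omega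
  have hh0 : h ≠ 0 := by
    rw [hh, Ne, pow2_eq_zero_iff]; omega
  have h20 : (2 : ZMod (2 ^ (M + 2))) ≠ 0 := by
    have := pow2_eq_zero_iff (n := M + 2) (j := 1)
    rw [pow_one] at this
    rw [Ne, this]; omega
  have hfix : ∀ (x : ZMod (2 ^ (M + 2))) (a : ZMod (2 ^ (M + 2)) × ZMod (2 ^ (M + 2))),
      Fixd 2 x a ↔ x = 0 ∨ (x = h ∧ h * a.1 = 0) ∨ (2 * (1 + x) = 0 ∧ a.1 = x) := by
    rintro x ⟨t, d⟩
    unfold Fixd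
    dsimp only
    constructor
    · rintro ⟨e1, e2⟩
      rcases unit_or_even x with hx | ⟨y, rfl⟩
      · right; right
        have e3 : 2 + 2 * t = 0 := hx.mul_right_eq_zero.1 e1
        have e4 : x * (4 * (1 + x) * d + t - x) = 0 := by
          linear_combination e2 - x ^ 2 * e3
        rw [hx.mul_right_eq_zero] at e4
        have e5 : (2 * (1 + x)) * (1 + 2 * (-2 * d)) = 0 := by
          linear_combination e3 - 2 * e4
        rw [(isUnit_one_add_two _).mul_left_eq_zero] at e5
        exact ⟨e5, by linear_combination e4 - 2 * d * e5⟩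
      · rcases unit_or_even t with ht | ⟨s, rfl⟩
        · left
          have e4 : (2 * y) * (t * (1 + 2 * ((2 + 4 * y) * d * (↑ht.unit⁻¹ : ZMod (2 ^ (M + 2)))
              + 2 * y + y * (↑ht.unit⁻¹ : ZMod (2 ^ (M + 2)))))) = 0 := by
            have hti : t * (↑ht.unit⁻¹ : ZMod (2 ^ (M + 2))) = 1 := ht.mul_val_inv
            linear_combination e2 + (2 * y) * (2 * (2 + 4 * y) * d + 2 * y) * hti
          rw [(ht.mul (isUnit_one_add_two _)).mul_left_eq_zero] at e4
          exact e4
        · have e4 : (2 * (2 * y)) * (1 + 2 * s) = 0 := by linear_combination e1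
          rw [(isUnit_one_add_two _).mul_left_eq_zero, ann_two] at e4
          rcases e4 with e4 | e4
          · exact Or.inl e4
          · right; left
            refine ⟨e4, ?_⟩
            linear_combination s * hh2
    · rintro (rfl | ⟨rfl, e⟩ | ⟨e, rfl⟩)
      · simp
      · constructor
        · linear_combination (1 + t) * hh2
        · linear_combination (2 + 2 * h) * d * hh2 + (1 + 2 * h) * e + hhh
      · constructor
        · linear_combination t * e
        · linear_combination (2 * t * d + t ^ 2) * e
  have hcard : ∀ x : ZMod (2 ^ (M + 2)),
      Nat.card {a : ZMod (2 ^ (M + 2)) × ZMod (2 ^ (M + 2)) // Fixd 2 x a} =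
      (if x = 0 then 2 ^ (M + 2) * 2 ^ (M + 2) else 0) +
      (if x = h then 2 ^ (M + 1) * 2 ^ (M + 2) else 0) +
      (if 2 * (1 + x) = 0 then 2 ^ (M + 2) else 0) := by
    intro x
    by_cases hx0 : x = 0
    · subst hx0
      rw [card_univ_sub _ (fun a => (hfix 0 a).2 (Or.inl rfl)), Nat.card_prod, Nat.card_zmod,
        if_pos rfl, if_neg hh0.symm, if_neg (by simpa using h20)]
      simp
    · by_cases hxh : x = h
      · have h3 : ¬ (2 * (1 + x) = 0) := by
          rw [hxh, mul_add, hh2]; simpa using h20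
        rw [card_congr_sub _ (fun a => h * a.1 = 0) (fun a => by rw [hfix]; tauto),
          card_fst_sub (fun t => h * t = 0), card_ann2 (by omega), Nat.card_zmod,
          if_neg hx0, if_pos hxh, if_neg h3]
        simp
      · by_cases hx1 : 2 * (1 + x) = 0
        · rw [card_congr_sub _ (fun a => a.1 = x) (fun a => by rw [hfix]; tauto),
            card_fst_sub (fun t => t = x), Nat.card_zmod, if_neg hx0, if_neg hxh, if_pos hx1]
          simp
        · rw [card_empty_sub _ (fun a => by rw [hfix]; tauto), if_neg hx0, if_neg hxh, if_neg hx1]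
  simp_rw [hcard] at h1
  have h4 : ∑ x : ZMod (2 ^ (M + 2)), (if 2 * (1 + x) = 0 then 2 ^ (M + 2) else 0) =
      2 * 2 ^ (M + 2) := by
    rw [← Finset.sum_filter, Finset.sum_const, smul_eq_mul]
    congr 1
    rw [← Fintype.card_subtype, ← Nat.card_eq_fintype_card]
    have := card_ann2 (m := 1) (n := M + 2) (by omega)
    rw [pow_one, pow_one] at this
    refine Eq.trans ?_ this
    exact Nat.card_congr ((Equiv.addLeft 1).subtypeEquiv fun a => Iff.rfl)
  rw [Finset.sum_add_distrib, Finset.sum_add_distrib, h4, Finset.sum_ite_eq', Finset.sum_ite_eq',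
    if_pos (Finset.mem_univ _), if_pos (Finset.mem_univ _), Nat.card_zmod, ← add_mul, ← add_mul] at h1
  rw [Nat.eq_of_mul_eq_mul_right (by positivity) h1]
  ring

lemma card_relK_zero (q : ZMod (2 ^ 0)) : Nat.card (Quot (relK q)) = 1 := by
  have : Subsingleton (ZMod (2 ^ 0)) := by
    rw [pow_zero]; infer_instance
  rw [Nat.card_eq_one_iff_unique]
  refine ⟨⟨fun a b => ?_⟩, ⟨Quot.mk _ (0, 0)⟩⟩
  induction a using Quot.ind
  induction b using Quot.ind
  congr 1
  exact Subsingleton.elim _ _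

/-- Depth zero. -/
lemma card_rel0_two (N : ℕ) :
    Nat.card (Quot (rel0 (R := ZMod (2 ^ (N + 3))))) = 3 * 2 ^ (N + 2) + 4 := by
  set h : ZMod (2 ^ (N + 3)) := 2 ^ (N + 2) with hh
  have hh2 : 2 * h = 0 := (ann_two h).2 (Or.inr rfl)
  have hh0 : h ≠ 0 := by
    rw [hh, Ne, pow2_eq_zero_iff]; omega
  have h40 : (4 : ZMod (2 ^ (N + 3))) ≠ 0 := by
    have := pow2_eq_zero_iff (n := N + 3) (j := 2)
    rw [show (4 : ZMod (2 ^ (N + 3))) = 2 ^ 2 by norm_num, Ne, this]; omega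
  have hwu : IsUnit (1 + h) := by
    have := isUnit_one_add_pow2 (m := N + 3) (k := N + 2) (by omega) 1
    rwa [mul_one] at this
  obtain ⟨w, hw⟩ := hwu
  have hsq : ∀ u : (ZMod (2 ^ (N + 3)))ˣ, u ^ 2 = 1 ↔ u = 1 ∨ u = w ∨ u = -1 ∨ u = -w := by
    intro u
    have hv : u ^ 2 = 1 ↔ (u : ZMod (2 ^ (N + 3))) ^ 2 = 1 := by
      rw [Units.ext_iff, Units.val_pow_eq_pow_val, Units.val_one]
    rw [hv]
    simp only [Units.ext_iff, Units.val_neg, Units.val_one, hw]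
    constructor
    · intro e
      rcases unit_or_even ((u : ZMod (2 ^ (N + 3))) - 1) with hu | ⟨y, hy⟩
      · exfalso
        have : ((u : ZMod (2 ^ (N + 3))) - 1) * (u + 1) = 0 := by linear_combination e
        rw [hu.mul_right_eq_zero] at this
        have h5 : (u : ZMod (2 ^ (N + 3))) - 1 = 2 * (-1) := by linear_combination this
        rw [h5] at hu
        have h6 := (isUnit_of_mul_isUnit_left hu).pow (N + 3)
        rw [pow2_eq_zero_iff.2 le_rfl] at h6
        have := nontriv (p := 2) (n := N + 3) (by omega)
        exact not_isUnit_zero h6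
      · have e2 : y * (1 + y) * 4 = 0 := by
          have : (u : ZMod (2 ^ (N + 3))) = 1 + 2 * y := by linear_combination hy
          rw [this] at e
          linear_combination e
        rcases unit_or_even y with hyu | ⟨z, rfl⟩
        · right; right
          have e3 : y * (2 * (u + 1)) = 0 := by linear_combination e2 + 2 * y * hy
          rw [hyu.mul_right_eq_zero, ann_two] at e3
          rcases e3 with e3 | e3
          · left; linear_combination e3
          · right; rw [← hh] at e3; linear_combination e3 + hh2
        · have e3 : (2 * (u - 1)) * (1 + 2 * z) = 0 := by
            linear_combination e2 + 2 * (1 + 2 * z) * hy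
          rw [(isUnit_one_add_two _).mul_left_eq_zero, ann_two] at e3
          rcases e3 with e3 | e3
          · left; linear_combination e3
          · right; left; rw [← hh] at e3; linear_combination e3
    · have hhh : h * h = 0 := by
        rw [hh, ← pow_add, pow2_eq_zero_iff]; omega
      rintro (e | e | e | e) <;> rw [e]
      · ring
      · linear_combination hh2 + hhh
      · ring
      · linear_combination hh2 + hhh
  have d1 : (1 : (ZMod (2 ^ (N + 3)))ˣ) ≠ w := by
    simp only [Ne, Units.ext_iff, Units.val_one, hw]
    intro e; exact hh0 (by linear_combination -e)
  have d2 : (1 : (ZMod (2 ^ (N + 3)))ˣ) ≠ -1 := by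
    simp only [Ne, Units.ext_iff, Units.val_one, Units.val_neg]
    intro e; exact h40 (by linear_combination 2 * e)
  have d3 : (1 : (ZMod (2 ^ (N + 3)))ˣ) ≠ -w := by
    simp only [Ne, Units.ext_iff, Units.val_one, Units.val_neg, hw]
    intro e; exact h40 (by linear_combination 2 * e - hh2)
  have d4 : w ≠ -1 := by
    simp only [Ne, Units.ext_iff, Units.val_one, Units.val_neg, hw]
    intro e; exact h40 (by linear_combination 2 * e - hh2)
  have d5 : w ≠ -w := by
    simp only [Ne, Units.ext_iff, Units.val_neg, hw]
    intro e; exact h40 (by linear_combination 2 * e - 2 * hh2)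
  have d6 : -1 ≠ -w := by
    intro e; exact d1 (neg_injective e)
  have c2 : Nat.card {t : ZMod (2 ^ (N + 3)) // 2 * t = 0} = 2 := by
    have := card_ann2 (m := 1) (n := N + 3) (by omega)
    simpa using this
  rw [card_rel0]
  have hsum : ∀ f : (ZMod (2 ^ (N + 3)))ˣ → ℕ, (∑ u, if u ^ 2 = 1 then f u else 0) =
      f 1 + f w + f (-1) + f (-w) := by
    intro f
    rw [← Finset.sum_filter]
    have : Finset.filter (fun u : (ZMod (2 ^ (N + 3)))ˣ => u ^ 2 = 1) Finset.univ =
        {1, w, -1, -w} := by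
      ext u
      simp [hsq]
    rw [this, Finset.sum_insert (by simp [d1, d2, d3]), Finset.sum_insert (by simp [d4, d5]),
      Finset.sum_insert (by simpa using d6), Finset.sum_singleton]
    ring
  rw [hsum]
  have v1 : Nat.card {t : ZMod (2 ^ (N + 3)) //
      ((1 : (ZMod (2 ^ (N + 3)))ˣ) : ZMod (2 ^ (N + 3))) * t = t} = 2 ^ (N + 3) := by
    rw [card_univ_sub _ (fun a => by simp), Nat.card_zmod]
  have v2 : Nat.card {t : ZMod (2 ^ (N + 3)) // (w : ZMod (2 ^ (N + 3))) * t = t} =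
      2 ^ (N + 2) := by
    rw [← card_ann2 (m := N + 2) (n := N + 3) (by omega)]
    refine card_congr_sub _ _ fun a => ?_
    rw [hw, ← hh]
    exact ⟨fun e => by linear_combination e, fun e => by linear_combination e⟩
  have v3 : Nat.card {t : ZMod (2 ^ (N + 3)) //
      ((-1 : (ZMod (2 ^ (N + 3)))ˣ) : ZMod (2 ^ (N + 3))) * t = t} = 2 := by
    refine (card_congr_sub _ _ fun a => ?_).trans c2
    rw [Units.val_neg, Units.val_one]
    exact ⟨fun e => by linear_combination -e, fun e => by linear_combination -e⟩
  have v4 : Nat.card {t : ZMod (2 ^ (N + 3)) //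
      ((-w : (ZMod (2 ^ (N + 3)))ˣ) : ZMod (2 ^ (N + 3))) * t = t} = 2 := by
    refine (card_congr_sub _ _ fun a => ?_).trans c2
    rw [Units.val_neg, hw]
    have hu := isUnit_one_add_pow2 (m := N + 3) (k := N + 1) (by omega) 1
    have hh' : h = 2 * 2 ^ (N + 1) := by rw [hh]; ring
    rw [← hu.mul_right_eq_zero (b := 2 * a), hh']
    exact ⟨fun e => by linear_combination -e, fun e => by linear_combination -e⟩
  rw [v1, v2, v3, v4]
  ring

end two

theorem card_two (N : ℕ) :
    Nat.card (ConjClasses (PGL2 (ZMod (2 ^ (N + 3))))) = 3 * 2 ^ (N + 3) + 4 := by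
  rw [card_classes 2 (by omega), card_rel0_two, Finset.sum_range_succ, Finset.sum_range_succ']
  have e1 : ∀ m ∈ Finset.range (N + 1), Nat.card (Quot (relK
      (((2 : ℕ) : ZMod (2 ^ (m + 1))) ^ (N + 3 - (m + 1))))) = 3 * 2 ^ m := by
    intro m hm
    rw [Finset.mem_range] at hm
    have := card_relK_two m (N - m)
    rw [show N + 3 - (m + 1) = N - m + 2 by omega]
    simpa using this
  have e2 : Nat.card (Quot (relK
      (((2 : ℕ) : ZMod (2 ^ (N + 2))) ^ (N + 3 - (N + 2))))) = 3 * 2 ^ (N + 1) + 2 := by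
    have := card_relK_one N
    rw [show N + 3 - (N + 2) = 1 by omega]
    simpa using this
  rw [Finset.sum_congr rfl e1, e2, card_relK_zero, ← Finset.mul_sum]
  have e3 : ∑ i ∈ Finset.range (N + 1), 2 ^ i + 1 = 2 ^ (N + 1) := by
    have := Nat.geomSum_eq (le_refl 2) (N + 1)
    rw [this]
    have : 1 ≤ 2 ^ (N + 1) := Nat.one_le_two_pow
    omega
  rw [show N + 3 = (N + 1) + 2 by ring, pow_add 2 (N + 1) 2, ← e3, show N + 2 = (N + 1) + 1 by ring,
    pow_succ, ← e3]
  ring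

theorem card_odd (p : ℕ) [Fact p.Prime] (h2 : p ≠ 2) (n : ℕ) (hn : 1 ≤ n) :
    Nat.card (ConjClasses (PGL2 (ZMod (p ^ n)))) = p ^ n + 1 + ∑ m ∈ Finset.range n, p ^ m := by
  rw [card_classes p hn, card_rel0_odd p h2 hn]
  congr 1
  refine Finset.sum_congr rfl fun m hm => ?_
  rw [Finset.mem_range] at hm
  exact card_relK_odd p h2 (by omega)

end PGLCount

/-- The generating function of the numbers of conjugacy classes of the
finite groups `PGL_2(ℤ/p^nℤ)` is a rational power series over `ℚ`. -/
theorem statement16 (p : ℕ) [Fact p.Prime] :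
    ∃ P Q : Polynomial ℚ, Q.coeff 0 ≠ 0 ∧
      PowerSeries.mk (fun n => (Nat.card (ConjClasses (PGL2 (ZMod (p ^ n)))) : ℚ)) *
        (Q : PowerSeries ℚ) = (P : PowerSeries ℚ) := by
  by_cases h2 : p = 2
  · subst h2
    refine PGLCount.rational_of_eventually _ 2 3 4 fun n hn => ?_
    obtain ⟨N, rfl⟩ : ∃ N, n = N + 3 := ⟨n - 3, by omega⟩
    rw [PGLCount.card_two]
    push_cast
    ring
  · have hp : (p : ℚ) ≠ 1 := by exact_mod_cast (Fact.out : p.Prime).ne_one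
    have hp' : (p : ℚ) - 1 ≠ 0 := sub_ne_zero.2 hp
    refine PGLCount.rational_of_eventually _ p (1 + 1 / ((p : ℚ) - 1)) (1 - 1 / ((p : ℚ) - 1))
      fun n hn => ?_
    rw [PGLCount.card_odd p h2 n (by omega)]
    push_cast
    rw [geom_sum_eq hp]
    field_simp
    ring
end
end
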